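/- Let 𝔾' be obtained from 𝔾 by a stabilization of type X:SW, with splitting GC•(𝔾₄') = I₄ ⊕ N₄. Then 𝓗_{X₂}^{I₄} ∘ 𝓗_{O₁}• = Id on I₄, and moreover 𝓗_{X₂}^{I₄} ∘ ∂_{I₄}^{N₄} = V₁ + V₂ (= V₁ − V₂ over 𝔽 = ℤ/2ℤ) as maps I₄ → I₄. -/

import Mathlib

/-!
Combinatorial model of toroidal grid diagrams, their 4-fold covers, and the
double-point enhanced grid complex (over 𝔽 = ℤ/2ℤ), following Lipshitz and
Ozsváth–Szabó–Sarkar conventions.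

* The torus is modelled by `ZMod n × ZMod n`: the horizontal circle `α_j` and
  vertical circle `β_k` meet at the point `(k, j)`; the square `(k, j)` is the
  one with south-west corner at the point `(k, j)`;  the `O`- and `X`-markings
  of column `k` occupy squares `(k, Orow k)` and `(k, Xrow k)`.
* A grid state is a bijection (column ↦ row), i.e. a permutation of `ZMod n`.
* The 4-fold cover `𝔾₄` lives on `ZMod (2n) × ZMod (2n)`, with the covering
  map `pr` reducing coordinates mod `n`.  A grid state of `𝔾₄` is the preimage
  of a grid state of `𝔾`, so grid states of `𝔾₄` are canonically identified
  with grid states of `𝔾`; similarly the free module `GC` underlying both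
  `GC•(𝔾)` and `GC•(𝔾₄)` is the same, and the identification `J₄` is the
  identity map.
* Rectangles are recorded by their two vertical circles (west/east) and two
  horizontal circles (south/north); "rectangle from x₄ to y₄" is the boundary
  condition `∂(∂_α(r + Nr + Er + NEr)) = y₄ - x₄` (and the `∂_β` analogue),
  expressed via corner-point indicator functions.  Each `N,E`-equivalence class
  of rectangles in `𝔾₄` contains exactly one *normalized* representative
  (west circle and south circle in the first fundamental domain), so sums over
  equivalence classes are sums over normalized representatives.
-/

noncomputable section

open scoped Classical

namespace GridHomology

/-- the ground field `𝔽 = ℤ/2ℤ` -/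
abbrev F : Type := ZMod 2

/-- A toroidal grid diagram of grid number `n`. -/
structure GridDiagram (n : ℕ) where
  Orow : ZMod n → ZMod n
  Xrow : ZMod n → ZMod n
  hO : Function.Bijective Orow
  hX : Function.Bijective Xrow
  hOX : ∀ i, Orow i ≠ Xrow i

/-- A grid state: one point on each horizontal and each vertical circle. -/
abbrev GridState (n : ℕ) := Equiv.Perm (ZMod n)

instance twoMulNeZero (n : ℕ) [NeZero n] : NeZero (2 * n) :=
  ⟨fun h => NeZero.ne n (by omega)⟩

/-- membership in the cyclic (going east/north) interval `[u, v)` -/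
def inIco {m : ℕ} (u v k : ZMod m) : Prop := (k - u).val < (v - u).val

/-- membership in the open cyclic interval `(u, v)` -/
def inIoo {m : ℕ} (u v k : ZMod m) : Prop :=
  0 < (k - u).val ∧ (k - u).val < (v - u).val

instance {m : ℕ} (u v k : ZMod m) : Decidable (inIco u v k) :=
  inferInstanceAs (Decidable (_ < _))

instance {m : ℕ} (u v k : ZMod m) : Decidable (inIoo u v k) :=
  inferInstanceAs (Decidable (_ ∧ _))

/-- Rectangle data on the `m × m` torus: west and east vertical circles,
south and north horizontal circles. -/
structure Rect (m : ℕ) where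
  cW : ZMod m
  cE : ZMod m
  rS : ZMod m
  rN : ZMod m
deriving DecidableEq

instance (m : ℕ) [NeZero m] : Fintype (Rect m) :=
  Fintype.ofEquiv (ZMod m × ZMod m × ZMod m × ZMod m)
    { toFun := fun p => ⟨p.1, p.2.1, p.2.2.1, p.2.2.2⟩
      invFun := fun r => ⟨r.cW, r.cE, r.rS, r.rN⟩
      left_inv := fun _ => rfl
      right_inv := fun _ => rfl }

/-- local multiplicity of a rectangle at a square of the torus -/
def Rect.mult {m : ℕ} (r : Rect m) (sq : ZMod m × ZMod m) : ℕ :=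
  if inIco r.cW r.cE sq.1 ∧ inIco r.rS r.rN sq.2 then 1 else 0

/-- `r` is an (embedded, not necessarily empty) rectangle from `x` to `y` in `𝔾`:
its south-west and north-east corners lie in `x`, its south-east and north-west
corners lie in `y`, and `x`, `y` agree away from the two vertical circles of `r`. -/
def IsRectFrom {m : ℕ} (x y : GridState m) (r : Rect m) : Prop :=
  r.cW ≠ r.cE ∧ r.rS ≠ r.rN ∧
  x r.cW = r.rS ∧ x r.cE = r.rN ∧ y r.cW = r.rN ∧ y r.cE = r.rS ∧
  ∀ k, k ≠ r.cW → k ≠ r.cE → x k = y k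

/-- point-measure of a rectangle in `𝔾` at a grid state `w`: the sum over the
points of `w` of the average of the four adjacent local multiplicities -/
def Rect.pm {m : ℕ} [NeZero m] (w : GridState m) (r : Rect m) : ℚ :=
  (∑ k : ZMod m, ((r.mult (k - 1, w k - 1) + r.mult (k, w k - 1) +
      r.mult (k - 1, w k) + r.mult (k, w k) : ℕ) : ℚ)) / 4

/-- `m(r) = #(Int r ∩ x)` -/
def Rect.intCount {m : ℕ} [NeZero m] (x : GridState m) (r : Rect m) : ℕ :=
  (Finset.univ.filter fun k => inIoo r.cW r.cE k ∧ inIoo r.rS r.rN (x k)).card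

/-- `O_i(r)` in `𝔾` -/
def Ocount {m : ℕ} (G : GridDiagram m) (r : Rect m) (i : ZMod m) : ℕ :=
  r.mult (i, G.Orow i)

/-- `X_i(r)` in `𝔾` -/
def Xcount {m : ℕ} (G : GridDiagram m) (r : Rect m) (i : ZMod m) : ℕ :=
  r.mult (i, G.Xrow i)

/-- `r ∩ 𝕏 = ∅` -/
def XDisjoint {m : ℕ} (G : GridDiagram m) (r : Rect m) : Prop :=
  ∀ i, Xcount G r i = 0

/-! ### The 4-fold cover -/

/-- the covering projection `π₄ : 𝔾₄ → 𝔾` on coordinates -/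
def pr {n : ℕ} (a : ZMod (2 * n)) : ZMod n :=
  ZMod.castHom (dvd_mul_left n 2) (ZMod n) a

/-- indicator function (as a formal sum of points) of the lifted grid state `x₄` -/
def stInd {n : ℕ} (x : GridState n) (p : ZMod (2 * n) × ZMod (2 * n)) : ℤ :=
  if x (pr p.1) = pr p.2 then 1 else 0

/-- `∂(∂_α r)` as a formal sum of points: `SE + NW − SW − NE` -/
def cornerA {m : ℕ} (r : Rect m) (p : ZMod m × ZMod m) : ℤ :=
  (if p = (r.cE, r.rS) then 1 else 0) + (if p = (r.cW, r.rN) then 1 else 0)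
    - (if p = (r.cW, r.rS) then 1 else 0) - (if p = (r.cE, r.rN) then 1 else 0)

/-- `∂(∂_β r)` as a formal sum of points: `NE + SW − SE − NW` -/
def cornerB {m : ℕ} (r : Rect m) (p : ZMod m × ZMod m) : ℤ :=
  (if p = (r.cE, r.rN) then 1 else 0) + (if p = (r.cW, r.rS) then 1 else 0)
    - (if p = (r.cE, r.rS) then 1 else 0) - (if p = (r.cW, r.rN) then 1 else 0)

/-- northward translation `N` by `n` rows -/
def trN {n : ℕ} (r : Rect (2 * n)) : Rect (2 * n) :=
  ⟨r.cW, r.cE, r.rS + (n : ZMod (2 * n)), r.rN + (n : ZMod (2 * n))⟩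

/-- eastward translation `E` by `n` columns -/
def trE {n : ℕ} (r : Rect (2 * n)) : Rect (2 * n) :=
  ⟨r.cW + (n : ZMod (2 * n)), r.cE + (n : ZMod (2 * n)), r.rS, r.rN⟩

/-- `r` is a rectangle from `x₄` to `y₄` in the 4-fold diagram `𝔾₄`:
`∂(∂_α (r + Nr + Er + NEr)) = y₄ − x₄` and `∂(∂_β (r + Nr + Er + NEr)) = x₄ − y₄`. -/
def IsRect4From {n : ℕ} (x y : GridState n) (r : Rect (2 * n)) : Prop :=
  r.cW ≠ r.cE ∧ r.rS ≠ r.rN ∧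
  (∀ p, cornerA r p + cornerA (trN r) p + cornerA (trE r) p + cornerA (trN (trE r)) p
      = stInd y p - stInd x p) ∧
  (∀ p, cornerB r p + cornerB (trN r) p + cornerB (trE r) p + cornerB (trN (trE r)) p
      = stInd x p - stInd y p)

/-- the canonical (normalized) representative of each `{r, Nr, Er, NEr}`
equivalence class: west and south coordinates lie in the first fundamental domain -/
def normal4 {n : ℕ} (r : Rect (2 * n)) : Prop := r.cW.val < n ∧ r.rS.val < n

instance {n : ℕ} (r : Rect (2 * n)) : Decidable (normal4 r) :=
  inferInstanceAs (Decidable (_ ∧ _))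

/-- `O_i[r₄]`: total multiplicity of `r₄` at the four lifts of `O_i` -/
def O4count {n : ℕ} [NeZero n] (G : GridDiagram n) (r : Rect (2 * n)) (i : ZMod n) : ℕ :=
  ∑ p : ZMod (2 * n) × ZMod (2 * n),
    if pr p.1 = i ∧ pr p.2 = G.Orow i then r.mult p else 0

/-- `X_i[r₄]` -/
def X4count {n : ℕ} [NeZero n] (G : GridDiagram n) (r : Rect (2 * n)) (i : ZMod n) : ℕ :=
  ∑ p : ZMod (2 * n) × ZMod (2 * n),
    if pr p.1 = i ∧ pr p.2 = G.Xrow i then r.mult p else 0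

/-- `r₄ ∩ π₄⁻¹(𝕏) = ∅` -/
def XDisjoint4 {n : ℕ} [NeZero n] (G : GridDiagram n) (r : Rect (2 * n)) : Prop :=
  ∀ i, X4count G r i = 0

/-- point-measure of a domain (an integer-valued multiplicity function on the
squares of `𝔾₄`) at the lifted grid state `w₄` -/
def pm4 {n : ℕ} [NeZero n] (w : GridState n) (ψ : ZMod (2 * n) × ZMod (2 * n) → ℤ) : ℚ :=
  (∑ p : ZMod (2 * n) × ZMod (2 * n),
    if w (pr p.1) = pr p.2 then
      ((ψ (p.1 - 1, p.2 - 1) + ψ (p.1, p.2 - 1) + ψ (p.1 - 1, p.2) + ψ p : ℤ) : ℚ)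
    else 0) / 4

/-- a rectangle of `𝔾₄` viewed as a domain -/
def Rect.dom4 {n : ℕ} (r : Rect (2 * n)) : ZMod (2 * n) × ZMod (2 * n) → ℤ :=
  fun p => (r.mult p : ℤ)

/-- point-measure `p_{w₄}[r₄]` of a rectangle of `𝔾₄` -/
def rpm4 {n : ℕ} [NeZero n] (w : GridState n) (r : Rect (2 * n)) : ℚ :=
  pm4 w r.dom4

/-- `m[r₄] = (p_{x₄}[r₄] + p_{y₄}[r₄] − 1)/2`, as a rational number -/
def mQ4 {n : ℕ} [NeZero n] (x y : GridState n) (r : Rect (2 * n)) : ℚ :=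
  (rpm4 x r + rpm4 y r - 1) / 2

/-- `m[r₄]` as a natural number (the exponent of `v`) -/
def m4 {n : ℕ} [NeZero n] (x y : GridState n) (r : Rect (2 * n)) : ℕ :=
  (⌊mQ4 x y r⌋).toNat

/-! ### Maslov and Alexander gradings (via the planar counting function `J`) -/

/-- the points of a planar fundamental domain associated to `f`, in doubled
coordinates (grid states at even positions, markings at odd positions) -/
def ptsOf {m : ℕ} [NeZero m] (f : ZMod m → ZMod m) (off : ℕ) : Finset (ℕ × ℕ) :=
  Finset.univ.image fun k => (2 * k.val + off, 2 * (f k).val + off)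

/-- `I(P,Q)`: pairs `(p,q)` with `q` strictly above and strictly to the right of `p` -/
def Icnt (P Q : Finset (ℕ × ℕ)) : ℕ :=
  ∑ p ∈ P, (Q.filter fun q => p.1 < q.1 ∧ p.2 < q.2).card

/-- `J(P,Q) = (I(P,Q) + I(Q,P))/2` -/
def Jq (P Q : Finset (ℕ × ℕ)) : ℚ := ((Icnt P Q : ℚ) + (Icnt Q P : ℚ)) / 2

/-- the Maslov-type grading `J(x,x) − 2 J(x,P) + J(P,P) + 1` for markings `P` -/
def MaslovOf {m : ℕ} [NeZero m] (f : ZMod m → ZMod m) (x : GridState m) : ℚ :=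
  Jq (ptsOf (⇑x) 0) (ptsOf (⇑x) 0) - 2 * Jq (ptsOf (⇑x) 0) (ptsOf f 1)
    + Jq (ptsOf f 1) (ptsOf f 1) + 1

/-- the Maslov grading `M(x) = M_𝕆(x)` -/
def MaslovO {m : ℕ} [NeZero m] (G : GridDiagram m) (x : GridState m) : ℚ :=
  MaslovOf G.Orow x

/-- `M_𝕏(x)` -/
def MaslovX {m : ℕ} [NeZero m] (G : GridDiagram m) (x : GridState m) : ℚ :=
  MaslovOf G.Xrow x

/-- the Alexander grading `A(x) = (M_𝕆(x) − M_𝕏(x) − (n−1))/2` -/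
def Alex {m : ℕ} [NeZero m] (G : GridDiagram m) (x : GridState m) : ℚ :=
  (MaslovO G x - MaslovX G x - ((m : ℚ) - 1)) / 2

/-! ### The double-point enhanced grid complex -/

/-- the ring `𝔽[V₁, …, V_n, v]`: `V_i = X (some i)`, `v = X none` -/
abbrev Rng (n : ℕ) : Type := MvPolynomial (Option (ZMod n)) F

/-- the free `𝔽[V₁,…,V_n,v]`-module on the set of grid states; it underlies both
`GC•(𝔾)` and `GC•(𝔾₄)` (their grid states being canonically identified) -/
abbrev GC (n : ℕ) := GridState n →₀ Rng n

/-- the variable `V_i` -/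
def Vv {n : ℕ} (i : ZMod n) : Rng n := MvPolynomial.X (some i)

/-- the double-point variable `v` -/
def vV {n : ℕ} : Rng n := MvPolynomial.X none

/-- the `𝔽[V₁,…,V_n,v]`-linear map determined by values on grid states -/
def basisMap {n : ℕ} (f : GridState n → GC n) : GC n →ₗ[Rng n] GC n :=
  Finsupp.lsum (Rng n) fun x => LinearMap.toSpanSingleton (Rng n) (GC n) (f x)

/-- the weight `V₁^{O₁[r₄]} ⋯ V_n^{O_n[r₄]} v^{m[r₄]}` of a rectangle of `𝔾₄` -/
def wt4 {n : ℕ} [NeZero n] (G : GridDiagram n) (x y : GridState n) (r : Rect (2 * n)) :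
    Rng n :=
  (∏ i : ZMod n, Vv i ^ O4count G r i) * vV ^ m4 x y r

/-- the differential `∂₄•` of `GC•(𝔾₄)`: counts `N,E`-equivalence classes of
rectangles (via their normalized representatives) disjoint from `π₄⁻¹(𝕏)` -/
def diff4 {n : ℕ} [NeZero n] (G : GridDiagram n) : GC n →ₗ[Rng n] GC n :=
  basisMap fun x => ∑ y : GridState n,
    ∑ r ∈ Finset.univ.filter
        (fun r : Rect (2 * n) => IsRect4From x y r ∧ normal4 r ∧ XDisjoint4 G r),
      Finsupp.single y (wt4 G x y r)

/-- the weight of a rectangle of `𝔾` -/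
def wtB {n : ℕ} [NeZero n] (G : GridDiagram n) (x : GridState n) (r : Rect n) : Rng n :=
  (∏ i : ZMod n, Vv i ^ Ocount G r i) * vV ^ Rect.intCount x r

/-- the differential `∂•` of the double-point enhanced grid complex `GC•(𝔾)` -/
def diffB {n : ℕ} [NeZero n] (G : GridDiagram n) : GC n →ₗ[Rng n] GC n :=
  basisMap fun x => ∑ y : GridState n,
    ∑ r ∈ Finset.univ.filter
        (fun r : Rect n => IsRectFrom x y r ∧ XDisjoint G r),
      Finsupp.single y (wtB G x r)

/-- `z` is homogeneous of bidegree `(d, s)` for the (Maslov, Alexander) bigrading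
extended by `M(V₁^{k₁}⋯V_n^{k_n} v^m ⋅ x) = M(x) − 2Σkᵢ + 2m`,
`A(V₁^{k₁}⋯V_n^{k_n} v^m ⋅ x) = A(x) − Σkᵢ`. -/
def IsHomog {n : ℕ} [NeZero n] (G : GridDiagram n) (z : GC n) (d s : ℚ) : Prop :=
  ∀ (y : GridState n) (k : Option (ZMod n) →₀ ℕ), MvPolynomial.coeff k (z y) ≠ 0 →
    (MaslovO G y - 2 * ∑ i : ZMod n, (k (some i) : ℚ) + 2 * (k none : ℚ) = d) ∧
    (Alex G y - ∑ i : ZMod n, (k (some i) : ℚ) = s)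

/-- a linear map is homogeneous of degree `(a, b)` -/
def MapHomog {n : ℕ} [NeZero n] (G G' : GridDiagram n) (φ : GC n →ₗ[Rng n] GC n)
    (a b : ℚ) : Prop :=
  ∀ z d s, IsHomog G z d s → IsHomog G' (φ z) (d + a) (s + b)

/-- `𝔾` represents a knot: following the link (column `i` joins its `O` to the `X`
in the same row, etc.) visits every column -/
def IsKnot {n : ℕ} (G : GridDiagram n) : Prop :=
  ∀ i j : ZMod n, ∃ k : ℕ,
    (((Equiv.ofBijective G.Orow G.hO).trans (Equiv.ofBijective G.Xrow G.hX).symm) ^ k) i = j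

/-- the homotopy operator `𝓗_{X_j}•` counting equivalence classes of rectangles in
`𝔾₄` crossing the lifts of `X_j` exactly once and no other `X`-marking -/
def HXmap {n : ℕ} [NeZero n] (G : GridDiagram n) (j : ZMod n) : GC n →ₗ[Rng n] GC n :=
  basisMap fun x => ∑ y : GridState n,
    ∑ r ∈ Finset.univ.filter (fun r : Rect (2 * n) =>
        IsRect4From x y r ∧ normal4 r ∧ X4count G r j = 1 ∧
        ∀ k, k ≠ j → X4count G r k = 0),
      Finsupp.single y (wt4 G x y r)

/-! ### Commutation moves, pentagons and hexagons

`𝔾` and `𝔾'` differ by commuting the (adjacent) columns `c−1` and `c`; they are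
drawn on a common torus, sharing all markings and all circles except that the
vertical circle `β_c` of `𝔾` is replaced in `𝔾'` by a curve `γ_c` which passes
to the west of the marking line within the rows of the cyclic interval
`J = [h₁, h₂)` (which contains the markings of column `c−1`) and to the east of
it in the complementary rows (which contain the markings of column `c`);
`γ_c` crosses `β_c` at two points `a` (just south of the row-circle `h₂`) and
`b` (just south of `h₁`).  Grid states of `𝔾'` are again recorded as
permutations (the `γ`-point in row `j` replacing the `β_c`-point). -/

structure CommData (n : ℕ) where
  G : GridDiagram n
  G' : GridDiagram n
  c : ZMod n
  h₁ : ZMod n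
  h₂ : ZMod n
  hne : h₁ ≠ h₂
  hOA : inIco h₁ h₂ (G.Orow (c - 1))
  hXA : inIco h₁ h₂ (G.Xrow (c - 1))
  hOB : ¬ inIco h₁ h₂ (G.Orow c)
  hXB : ¬ inIco h₁ h₂ (G.Xrow c)
  hO'A : G'.Orow (c - 1) = G.Orow c
  hO'B : G'.Orow c = G.Orow (c - 1)
  hX'A : G'.Xrow (c - 1) = G.Xrow c
  hX'B : G'.Xrow c = G.Xrow (c - 1)
  hO' : ∀ k, k ≠ c - 1 → k ≠ c → G'.Orow k = G.Orow k
  hX' : ∀ k, k ≠ c - 1 → k ≠ c → G'.Xrow k = G.Xrow k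

/-- Pentagon data in the 4-fold torus `T₄`: the underlying rectangle
`I₄(p)` of `𝔾₄`, the side of the curved edge (`left = true` means the curved
vertical edge is the east edge of the rectangle), and the lifted height `hh`
of the crossing point (`a` or `b`) serving as the fifth corner. -/
structure Pent (n : ℕ) where
  rect : Rect (2 * n)
  left : Bool
  hh : ZMod (2 * n)
deriving DecidableEq

instance (n : ℕ) [NeZero n] : Fintype (Pent n) :=
  Fintype.ofEquiv (Rect (2 * n) × Bool × ZMod (2 * n))
    { toFun := fun p => ⟨p.1, p.2.1, p.2.2⟩
      invFun := fun p => ⟨p.rect, p.left, p.hh⟩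
      left_inv := fun _ => rfl
      right_inv := fun _ => rfl }

/-- the distinguished vertical edge lies on a lift of the curved circle -/
def onCedge {n : ℕ} (C : CommData n) (p : Pent n) : Prop :=
  if p.left then pr p.rect.cE = C.c else pr p.rect.cW = C.c

/-- the crossing point (at height just below the row circle `h`) lies strictly
inside the vertical extent of the rectangle -/
def heightOK {n : ℕ} (r : Rect (2 * n)) (h : ZMod (2 * n)) : Prop :=
  0 < (h - r.rS).val ∧ (h - r.rS).val ≤ (r.rN - r.rS).val

/-- a pentagon from `x₄ ∈ S₄(𝔾₄)` to `y₄' ∈ S₄(𝔾₄')` (with fifth corner at a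
lift of the distinguished point `a`) -/
def IsPentA {n : ℕ} (C : CommData n) (x y' : GridState n) (p : Pent n) : Prop :=
  IsRect4From x y' p.rect ∧ pr p.hh = C.h₂ ∧ onCedge C p ∧ heightOK p.rect p.hh

/-- a pentagon from `y₄' ∈ S₄(𝔾₄')` to `x₄ ∈ S₄(𝔾₄)` (fifth corner at a lift of `b`) -/
def IsPentB {n : ℕ} (C : CommData n) (y' x : GridState n) (p : Pent n) : Prop :=
  IsRect4From y' x p.rect ∧ pr p.hh = C.h₁ ∧ onCedge C p ∧ heightOK p.rect p.hh

/-- the rows along which the boundary of the pentagon runs along `γ` rather than `β_c` -/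
def detourA {n : ℕ} [NeZero n] (p : Pent n) : Finset (ZMod (2 * n)) :=
  if p.left then Finset.univ.filter (fun j => inIco p.rect.rS p.hh j)
  else Finset.univ.filter (fun j => inIco p.hh p.rect.rN j)

def detourB {n : ℕ} [NeZero n] (p : Pent n) : Finset (ZMod (2 * n)) :=
  if p.left then Finset.univ.filter (fun j => inIco p.hh p.rect.rN j)
  else Finset.univ.filter (fun j => inIco p.rect.rS p.hh j)

/-- marking-count correction along a curved edge: in a detour row `j`, if `γ` is
west (`π₄ j ∈ J`) the bigon sliver carries the column-`(c−1)` marking, otherwise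
it carries the column-`c` marking; the sliver is gained or lost according to
whether the region lies east (`east = true`) or west of the curved circle. -/
def adj {n : ℕ} [NeZero n] (C : CommData n) (f : ZMod n → ZMod n) (east : Bool)
    (D : Finset (ZMod (2 * n))) (i : ZMod n) : ℤ :=
  ∑ j ∈ D,
    if inIco C.h₁ C.h₂ (pr j) then
      (if i = C.c - 1 ∧ f (C.c - 1) = pr j then (if east then 1 else -1) else 0)
    else
      (if i = C.c ∧ f C.c = pr j then (if east then -1 else 1) else 0)

/-- `O_i[p₄]` for a pentagon counted by `P•` -/
def pentOA {n : ℕ} [NeZero n] (C : CommData n) (p : Pent n) (i : ZMod n) : ℤ :=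
  (O4count C.G p.rect i : ℤ) + adj C C.G.Orow (!p.left) (detourA p) i

def pentXA {n : ℕ} [NeZero n] (C : CommData n) (p : Pent n) (i : ZMod n) : ℤ :=
  (X4count C.G p.rect i : ℤ) + adj C C.G.Xrow (!p.left) (detourA p) i

def pentXDisjA {n : ℕ} [NeZero n] (C : CommData n) (p : Pent n) : Prop :=
  ∀ i, pentXA C p i = 0

def pentOB {n : ℕ} [NeZero n] (C : CommData n) (p : Pent n) (i : ZMod n) : ℤ :=
  (O4count C.G p.rect i : ℤ) + adj C C.G.Orow (!p.left) (detourB p) i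

def pentXB {n : ℕ} [NeZero n] (C : CommData n) (p : Pent n) (i : ZMod n) : ℤ :=
  (X4count C.G p.rect i : ℤ) + adj C C.G.Xrow (!p.left) (detourB p) i

def pentXDisjB {n : ℕ} [NeZero n] (C : CommData n) (p : Pent n) : Prop :=
  ∀ i, pentXB C p i = 0

/-- the weight `V₁^{O₁[p₄]}⋯V_n^{O_n[p₄]} v^{m[p₄]}`, with `m[p₄] = m[I₄(p₄)]` -/
def pentWtA {n : ℕ} [NeZero n] (C : CommData n) (x y' : GridState n) (p : Pent n) : Rng n :=
  (∏ i : ZMod n, Vv i ^ (pentOA C p i).toNat) * vV ^ m4 x y' p.rect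

def pentWtB {n : ℕ} [NeZero n] (C : CommData n) (y' x : GridState n) (p : Pent n) : Rng n :=
  (∏ i : ZMod n, Vv i ^ (pentOB C p i).toNat) * vV ^ m4 y' x p.rect

/-- the pentagon-counting map `P• : GC•(𝔾₄) → GC•(𝔾₄')` -/
def Pmap {n : ℕ} [NeZero n] (C : CommData n) : GC n →ₗ[Rng n] GC n :=
  basisMap fun x => ∑ y' : GridState n,
    ∑ p ∈ Finset.univ.filter (fun p : Pent n =>
        IsPentA C x y' p ∧ normal4 p.rect ∧ pentXDisjA C p),
      Finsupp.single y' (pentWtA C x y' p)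

/-- the pentagon-counting map `(P•)' : GC•(𝔾₄') → GC•(𝔾₄)` -/
def P'map {n : ℕ} [NeZero n] (C : CommData n) : GC n →ₗ[Rng n] GC n :=
  basisMap fun y' => ∑ x : GridState n,
    ∑ p ∈ Finset.univ.filter (fun p : Pent n =>
        IsPentB C y' x p ∧ normal4 p.rect ∧ pentXDisjB C p),
      Finsupp.single x (pentWtB C y' x p)

/-- Hexagon data: the underlying rectangle `I₄(h₄)` of `𝔾₄`, the side of its
curved edge, and the lifted heights of its two crossing-point corners
(`ha` a lift of `a`, `hb` a lift of `b`). -/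
structure Hex (n : ℕ) where
  rect : Rect (2 * n)
  left : Bool
  ha : ZMod (2 * n)
  hb : ZMod (2 * n)
deriving DecidableEq

instance (n : ℕ) [NeZero n] : Fintype (Hex n) :=
  Fintype.ofEquiv (Rect (2 * n) × Bool × ZMod (2 * n) × ZMod (2 * n))
    { toFun := fun p => ⟨p.1, p.2.1, p.2.2.1, p.2.2.2⟩
      invFun := fun p => ⟨p.rect, p.left, p.ha, p.hb⟩
      left_inv := fun _ => rfl
      right_inv := fun _ => rfl }

def onCedgeH {n : ℕ} (C : CommData n) (h : Hex n) : Prop :=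
  if h.left then pr h.rect.cE = C.c else pr h.rect.cW = C.c

/-- a hexagon from `x₄` to `y₄` (both states of `𝔾₄`) -/
def IsHex {n : ℕ} (C : CommData n) (x y : GridState n) (h : Hex n) : Prop :=
  IsRect4From x y h.rect ∧ pr h.ha = C.h₂ ∧ pr h.hb = C.h₁ ∧ onCedgeH C h ∧
  heightOK h.rect h.ha ∧ heightOK h.rect h.hb

/-- the rows between the two crossing-point corners of a hexagon -/
def detourH {n : ℕ} [NeZero n] (h : Hex n) : Finset (ZMod (2 * n)) :=
  if (h.ha - h.rect.rS).val < (h.hb - h.rect.rS).val then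
    Finset.univ.filter (fun j => inIco h.ha h.hb j)
  else Finset.univ.filter (fun j => inIco h.hb h.ha j)

def hexO {n : ℕ} [NeZero n] (C : CommData n) (h : Hex n) (i : ZMod n) : ℤ :=
  (O4count C.G h.rect i : ℤ) + adj C C.G.Orow (!h.left) (detourH h) i

def hexX {n : ℕ} [NeZero n] (C : CommData n) (h : Hex n) (i : ZMod n) : ℤ :=
  (X4count C.G h.rect i : ℤ) + adj C C.G.Xrow (!h.left) (detourH h) i

def hexXDisj {n : ℕ} [NeZero n] (C : CommData n) (h : Hex n) : Prop :=
  ∀ i, hexX C h i = 0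

def hexWt {n : ℕ} [NeZero n] (C : CommData n) (x y : GridState n) (h : Hex n) : Rng n :=
  (∏ i : ZMod n, Vv i ^ (hexO C h i).toNat) * vV ^ m4 x y h.rect

/-- the hexagon-counting map `H• : GC•(𝔾₄) → GC•(𝔾₄)` -/
def Hmap {n : ℕ} [NeZero n] (C : CommData n) : GC n →ₗ[Rng n] GC n :=
  basisMap fun x => ∑ y : GridState n,
    ∑ h ∈ Finset.univ.filter (fun h : Hex n =>
        IsHex C x y h ∧ normal4 h.rect ∧ hexXDisj C h),
      Finsupp.single y (hexWt C x y h)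

/-! ### Double-point enhanced grid homology -/

def cycles {n : ℕ} [NeZero n] (G : GridDiagram n) : Submodule (Rng n) (GC n) :=
  LinearMap.ker (diffB G)

def bdrIn {n : ℕ} [NeZero n] (G : GridDiagram n) : Submodule (Rng n) ↥(cycles G) :=
  Submodule.comap (cycles G).subtype (LinearMap.range (diffB G))

instance GHquotInst {n : ℕ} [NeZero n] (G : GridDiagram n) :
    HasQuotient ↥(cycles G) (Submodule (Rng n) ↥(cycles G)) :=
  Submodule.hasQuotient (R := Rng n) (M := ↥(cycles G))

/-- the double-point enhanced grid homology `GH•(𝔾)` -/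
abbrev GH {n : ℕ} [NeZero n] (G : GridDiagram n) := ↥(cycles G) ⧸ bdrIn G

/-- a homology class is homogeneous of degree `(d,s)` if it has a homogeneous
cycle representative -/
def GHhomog {n : ℕ} [NeZero n] (G : GridDiagram n) (h : GH G) (d s : ℚ) : Prop :=
  ∃ w : ↥(cycles G), (Submodule.Quotient.mk w : GH G) = h ∧ IsHomog G (w : GC n) d s

/-! ### Commutation and stabilization moves as relations on grid diagrams -/

/-- `𝔾` and `𝔾'` differ by a column commutation move -/
def IsColComm {n : ℕ} (G G' : GridDiagram n) : Prop :=
  ∃ C : CommData n, C.G = G ∧ C.G' = G'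

/-- the transposed grid diagram (exchanging the roles of rows and columns) -/
def GridDiagram.transpose {n : ℕ} (G : GridDiagram n) : GridDiagram n where
  Orow := ⇑(Equiv.ofBijective G.Orow G.hO).symm
  Xrow := ⇑(Equiv.ofBijective G.Xrow G.hX).symm
  hO := (Equiv.ofBijective G.Orow G.hO).symm.bijective
  hX := (Equiv.ofBijective G.Xrow G.hX).symm.bijective
  hOX := by
    intro i h
    apply G.hOX ((Equiv.ofBijective G.Orow G.hO).symm i)
    have h1 : G.Orow ((Equiv.ofBijective G.Orow G.hO).symm i) = i :=
      Equiv.ofBijective_apply_symm_apply G.Orow G.hO i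
    have h2 : G.Xrow ((Equiv.ofBijective G.Xrow G.hX).symm i) = i :=
      Equiv.ofBijective_apply_symm_apply G.Xrow G.hX i
    rw [h1, h, h2]

/-- `𝔾` and `𝔾'` differ by a row commutation move -/
def IsRowComm {n : ℕ} (G G' : GridDiagram n) : Prop :=
  IsColComm G.transpose G'.transpose

/-- collapse map identifying `a` and `a+1` (used to destabilize) -/
def coll {n : ℕ} (a k : ZMod (n + 1)) : ZMod n :=
  (a.val : ZMod n) + (((k - a).val - 1 : ℕ) : ZMod n)

/-- `𝔾'` is obtained from `𝔾` by a stabilization with new 2×2 block at columns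
`c', c'+1` and rows `r', r'+1`; the empty square of the block sits at the corner
selected by `(ec, er)` (east column?, north row?), and `xty` records whether the
block carries two `X`-markings (type `X:·`) or two `O`-markings (type `O:·`).
E.g. `(ec, er, xty) = (false, false, true)` is type `X:SW`, with
`O₁ = (c'+1, r'+1)`, `X₁ = (c', r'+1)`, `X₂ = (c'+1, r')`. -/
def IsStabAt {n : ℕ} (G : GridDiagram n) (G' : GridDiagram (n + 1))
    (c' r' : ZMod (n + 1)) (ec er xty : Bool) : Prop :=
  (if xty then
    G'.Orow (if ec then c' else c' + 1) = (if er then r' else r' + 1) ∧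
    G'.Xrow (if ec then c' + 1 else c') = (if er then r' else r' + 1) ∧
    G'.Xrow (if ec then c' else c' + 1) = (if er then r' + 1 else r') ∧
    G.Xrow (c'.val : ZMod n) = (r'.val : ZMod n) ∧
    G.Orow (c'.val : ZMod n) = coll r' (G'.Orow (if ec then c' + 1 else c'))
  else
    G'.Xrow (if ec then c' else c' + 1) = (if er then r' else r' + 1) ∧
    G'.Orow (if ec then c' + 1 else c') = (if er then r' else r' + 1) ∧
    G'.Orow (if ec then c' else c' + 1) = (if er then r' + 1 else r') ∧
    G.Orow (c'.val : ZMod n) = (r'.val : ZMod n) ∧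
    G.Xrow (c'.val : ZMod n) = coll r' (G'.Xrow (if ec then c' + 1 else c'))) ∧
  (∀ k : ZMod (n + 1), k ≠ c' → k ≠ c' + 1 →
    G.Orow (coll c' k) = coll r' (G'.Orow k) ∧ G.Xrow (coll c' k) = coll r' (G'.Xrow k))

/-- `𝔾'` is obtained from `𝔾` by a stabilization move of one of the standard types -/
def IsStab {n : ℕ} (G : GridDiagram n) (G' : GridDiagram (n + 1)) : Prop :=
  ∃ c' r' ec er xty, IsStabAt G G' c' r' ec er xty

/-! ### The stabilization machinery (type `X:SW`) for the 4-fold complexes -/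

/-- projection of `GC•(𝔾₄')` onto the span `I₄` of states containing the
distinguished point `c = (c'+1, r'+1)` -/
def pI {n : ℕ} (c' r' : ZMod (n + 1)) : GC (n + 1) →ₗ[Rng (n + 1)] GC (n + 1) :=
  basisMap fun x => if x (c' + 1) = r' + 1 then Finsupp.single x 1 else 0

/-- projection onto the complementary span `N₄` -/
def pN {n : ℕ} (c' r' : ZMod (n + 1)) : GC (n + 1) →ₗ[Rng (n + 1)] GC (n + 1) :=
  basisMap fun x => if x (c' + 1) = r' + 1 then 0 else Finsupp.single x 1

/-- the submodule `I₄` -/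
def Isub {n : ℕ} (c' r' : ZMod (n + 1)) : Submodule (Rng (n + 1)) (GC (n + 1)) :=
  Finsupp.supported (Rng (n + 1)) (Rng (n + 1)) {x : GridState (n + 1) | x (c' + 1) = r' + 1}

/-- the submodule `N₄` -/
def Nsub {n : ℕ} (c' r' : ZMod (n + 1)) : Submodule (Rng (n + 1)) (GC (n + 1)) :=
  Finsupp.supported (Rng (n + 1)) (Rng (n + 1)) {x : GridState (n + 1) | x (c' + 1) ≠ r' + 1}

/-- the components `∂_{I₄}^{I₄}`, `∂_{I₄}^{N₄}`, `∂_{N₄}^{N₄}` of `∂₄•` -/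
def dII {n : ℕ} [NeZero (n + 1)] (G' : GridDiagram (n + 1)) (c' r' : ZMod (n + 1)) :
    GC (n + 1) →ₗ[Rng (n + 1)] GC (n + 1) :=
  pI c' r' ∘ₗ diff4 G' ∘ₗ pI c' r'

def dIN {n : ℕ} [NeZero (n + 1)] (G' : GridDiagram (n + 1)) (c' r' : ZMod (n + 1)) :
    GC (n + 1) →ₗ[Rng (n + 1)] GC (n + 1) :=
  pN c' r' ∘ₗ diff4 G' ∘ₗ pI c' r'

def dNN {n : ℕ} [NeZero (n + 1)] (G' : GridDiagram (n + 1)) (c' r' : ZMod (n + 1)) :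
    GC (n + 1) →ₗ[Rng (n + 1)] GC (n + 1) :=
  pN c' r' ∘ₗ diff4 G' ∘ₗ pN c' r'

/-- section of the column collapse map, avoiding the new column `c'+1` -/
def sect {n : ℕ} (a : ZMod (n + 1)) (k : ZMod n) : ZMod (n + 1) :=
  a + (if k - (a.val : ZMod n) = 0 then 0
       else (((k - (a.val : ZMod n)).val + 1 : ℕ) : ZMod (n + 1)))

def stCollFun {n : ℕ} (c' r' : ZMod (n + 1)) (x : GridState (n + 1)) :
    ZMod n → ZMod n :=
  fun k => coll r' (x (sect c' k))

/-- the destabilized grid state `x` corresponding to `x' = x ∪ {c}` -/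
def stColl {n : ℕ} (c' r' : ZMod (n + 1)) (x : GridState (n + 1)) : GridState n :=
  if h : Function.Bijective (stCollFun c' r' x) then Equiv.ofBijective _ h else 1

/-- the promoted module `GC•(𝔾₄)[V₁]`: the free `𝔽[V₁,…,V_n,v]`-module on the
grid states of the destabilized diagram -/
abbrev GCP (n : ℕ) := GridState n →₀ Rng (n + 1)

def basisMapP {n : ℕ} (f : GridState n → GCP n) : GCP n →ₗ[Rng (n + 1)] GCP n :=
  Finsupp.lsum (Rng (n + 1)) fun x => LinearMap.toSpanSingleton (Rng (n + 1)) (GCP n) (f x)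

/-- the identification `e₄` (extended by zero on `N₄`) -/
def e4map {n : ℕ} (c' r' : ZMod (n + 1)) : GC (n + 1) →ₗ[Rng (n + 1)] GCP n :=
  Finsupp.lsum (Rng (n + 1)) fun x =>
    LinearMap.toSpanSingleton (Rng (n + 1)) (GCP n)
      (if x (c' + 1) = r' + 1 then Finsupp.single (stColl c' r' x) (1 : Rng (n + 1)) else 0)

/-- renaming of the variables of the destabilized diagram into those of `𝔾'` -/
def renUp {n : ℕ} (c' : ZMod (n + 1)) : Rng n →+* Rng (n + 1) :=
  (MvPolynomial.rename (Option.map (sect c')) :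
      MvPolynomial (Option (ZMod n)) F →ₐ[F] MvPolynomial (Option (ZMod (n + 1))) F).toRingHom

/-- the differential of the promoted complex `GC•(𝔾₄)[V₁]` -/
def diffP {n : ℕ} [NeZero n] (G : GridDiagram n) (c' : ZMod (n + 1)) :
    GCP n →ₗ[Rng (n + 1)] GCP n :=
  basisMapP fun x => ∑ y : GridState n,
    ∑ r ∈ Finset.univ.filter
        (fun r : Rect (2 * n) => IsRect4From x y r ∧ normal4 r ∧ XDisjoint4 G r),
      Finsupp.single y (renUp c' (wt4 G x y r))

/-- homogeneity on the promoted complex -/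
def IsHomogP {n : ℕ} [NeZero n] (G : GridDiagram n) (z : GCP n) (d s : ℚ) : Prop :=
  ∀ (y : GridState n) (k : Option (ZMod (n + 1)) →₀ ℕ), MvPolynomial.coeff k (z y) ≠ 0 →
    (MaslovO G y - 2 * ∑ i : ZMod (n + 1), (k (some i) : ℚ) + 2 * (k none : ℚ) = d) ∧
    (Alex G y - ∑ i : ZMod (n + 1), (k (some i) : ℚ) = s)

/-- the map counting equivalence classes of rectangles crossing `X₂` (the
`X`-marking of column `c'+1`) once and no other `X`-marking -/
def HX2map {n : ℕ} (G' : GridDiagram (n + 1)) (c' : ZMod (n + 1)) :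
    GC (n + 1) →ₗ[Rng (n + 1)] GC (n + 1) :=
  basisMap fun x => ∑ y : GridState (n + 1),
    ∑ r ∈ Finset.univ.filter (fun r : Rect (2 * (n + 1)) =>
        IsRect4From x y r ∧ normal4 r ∧ X4count G' r (c' + 1) = 1 ∧
        ∀ k, k ≠ c' + 1 → X4count G' r k = 0),
      Finsupp.single y (wt4 G' x y r)

/-- its component `𝓗_{X₂}^{I₄} : N₄ → I₄` -/
def hX2I {n : ℕ} (G' : GridDiagram (n + 1)) (c' r' : ZMod (n + 1)) :
    GC (n + 1) →ₗ[Rng (n + 1)] GC (n + 1) :=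
  pI c' r' ∘ₗ HX2map G' c' ∘ₗ pN c' r'

/-- weight with the variable `V_j` evaluated at `1` -/
def wtNo {n : ℕ} [NeZero n] (G : GridDiagram n) (x y : GridState n) (j : ZMod n)
    (r : Rect (2 * n)) : Rng n :=
  (∏ i ∈ Finset.univ.erase j, Vv i ^ O4count G r i) * vV ^ m4 x y r

/-- `𝓗_{O₁}•`: counts `X`-disjoint rectangles crossing `O₁` (the `O`-marking of
column `c'+1`) once, with `V₁` evaluated at `1` -/
def HO1map {n : ℕ} (G' : GridDiagram (n + 1)) (c' : ZMod (n + 1)) :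
    GC (n + 1) →ₗ[Rng (n + 1)] GC (n + 1) :=
  basisMap fun x => ∑ y : GridState (n + 1),
    ∑ r ∈ Finset.univ.filter (fun r : Rect (2 * (n + 1)) =>
        IsRect4From x y r ∧ normal4 r ∧ XDisjoint4 G' r ∧ O4count G' r (c' + 1) = 1),
      Finsupp.single y (wtNo G' x y (c' + 1) r)

/-- its component `I₄ → N₄` -/
def hO1N {n : ℕ} (G' : GridDiagram (n + 1)) (c' r' : ZMod (n + 1)) :
    GC (n + 1) →ₗ[Rng (n + 1)] GC (n + 1) :=
  pN c' r' ∘ₗ HO1map G' c' ∘ₗ pI c' r'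

/-! ### Grid diagrams of arbitrary size, and the moves of Cromwell's theorem -/

/-- a grid diagram of unspecified (positive) grid number -/
structure GDS where
  sz : ℕ+
  D : GridDiagram (sz : ℕ)

instance (p : ℕ+) : NeZero (p : ℕ) := ⟨p.ne_zero⟩

/-- a single commutation or stabilization move -/
def MoveRel (A B : GDS) : Prop :=
  (∃ h : (A.sz : ℕ) = (B.sz : ℕ),
      IsColComm (h ▸ A.D) B.D ∨ IsRowComm (h ▸ A.D) B.D) ∨
  (∃ h : (B.sz : ℕ) = (A.sz : ℕ) + 1, IsStab A.D (h ▸ B.D))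

/-- connected by a finite sequence of commutation moves and
stabilization/destabilization moves -/
def ConnectedByMoves (A B : GDS) : Prop :=
  Relation.ReflTransGen (fun X Y => MoveRel X Y ∨ MoveRel Y X) A B


/-! ### Helper lemmas -/

/-- the number of `t < d` with `t ≡ e mod N`, for `e < N`, `d ≤ 2N` -/
def Cc (N d e : ℕ) : ℕ := (if e < d then 1 else 0) + (if e + N < d then 1 else 0)

/-- the lift of a coordinate to the first fundamental domain -/
def lft {N : ℕ} (i : ZMod N) : ZMod (2 * N) := (i.val : ZMod (2 * N))

theorem pr_add' {N : ℕ} (u v : ZMod (2 * N)) : pr (u + v) = pr u + pr v :=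
  map_add _ _ _

theorem pr_nat {N : ℕ} (k : ℕ) : pr ((k : ℕ) : ZMod (2 * N)) = (k : ZMod N) :=
  map_natCast _ _

theorem pr_lft {N : ℕ} [NeZero N] (i : ZMod N) : pr (lft i) = i := by
  unfold lft
  rw [pr_nat, ZMod.natCast_zmod_val]

theorem val_off {M : ℕ} [NeZero M] (u : ZMod M) {e : ℕ} (he : e < M) :
    (u + (e : ZMod M) - u).val = e := by
  rw [add_sub_cancel_left, ZMod.val_natCast_of_lt he]

theorem add_val_sub {M : ℕ} [NeZero M] (u k : ZMod M) :
    u + (((k - u).val : ℕ) : ZMod M) = k := by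
  rw [ZMod.natCast_zmod_val]; ring

theorem N_ne_zero {N : ℕ} [NeZero N] : ((N : ℕ) : ZMod (2 * N)) ≠ 0 := by
  intro h
  rw [ZMod.natCast_eq_zero_iff] at h
  have := Nat.le_of_dvd (Nat.pos_of_ne_zero (NeZero.ne N)) h
  have := NeZero.ne N
  omega

theorem N_add_N {N : ℕ} : ((N : ℕ) : ZMod (2 * N)) + (N : ℕ) = 0 := by
  rw [← Nat.cast_add, ← two_mul, ZMod.natCast_self]

theorem pr_eq_iff_off {N : ℕ} [NeZero N] (u k : ZMod (2 * N)) (i : ZMod N) :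
    pr k = i ↔ k = u + (((i - pr u).val : ℕ) : ZMod (2 * N)) ∨
      k = u + (((i - pr u).val + N : ℕ) : ZMod (2 * N)) := by
  constructor
  · intro h
    have ht : (k - u).val < 2 * N := ZMod.val_lt _
    have hk := add_val_sub u k
    have h2 : i - pr u = (((k - u).val : ℕ) : ZMod N) := by
      rw [← h]
      nth_rewrite 1 [← hk]
      rw [pr_add', pr_nat]; ring
    have h3 : (i - pr u).val = (k - u).val % N := by
      rw [h2, ZMod.val_natCast]
    rw [h3]
    by_cases hlt : (k - u).val < N
    · left
      rw [Nat.mod_eq_of_lt hlt, hk]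
    · right
      have h4 : (k - u).val % N = (k - u).val - N := by
        rw [Nat.mod_eq_sub_mod (by omega), Nat.mod_eq_of_lt (by omega)]
      rw [h4, Nat.sub_add_cancel (by omega), hk]
  · rintro (h | h)
    · rw [h, pr_add', pr_nat, add_val_sub]
    · rw [h, pr_add', pr_nat, Nat.cast_add, ZMod.natCast_self, add_zero, add_val_sub]

theorem pr_eq_pr_iff {N : ℕ} [NeZero N] (k c : ZMod (2 * N)) :
    pr k = pr c ↔ k = c ∨ k = c + (N : ZMod (2 * N)) := by
  rw [pr_eq_iff_off c k (pr c)]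
  simp

theorem sum_fiber {N : ℕ} [NeZero N] (f : ZMod (2 * N) → ℕ) (u : ZMod (2 * N)) (i : ZMod N) :
    (∑ k, if pr k = i then f k else 0) =
      f (u + (((i - pr u).val : ℕ) : ZMod (2 * N))) +
      f (u + (((i - pr u).val + N : ℕ) : ZMod (2 * N))) := by
  rw [← Finset.sum_filter]
  have : (Finset.univ.filter fun k : ZMod (2 * N) => pr k = i) =
      {u + (((i - pr u).val : ℕ) : ZMod (2 * N)),
        u + (((i - pr u).val + N : ℕ) : ZMod (2 * N))} := by
    ext k
    simp only [Finset.mem_filter, Finset.mem_univ, true_and, Finset.mem_insert,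
      Finset.mem_singleton]
    exact pr_eq_iff_off u k i
  rw [this, Finset.sum_pair]
  intro h
  rw [Nat.cast_add, ← add_assoc] at h
  exact N_ne_zero (left_eq_add.mp h)

theorem fiber_count {N : ℕ} [NeZero N] (W i : ZMod N) {w : ℕ} (hw : w < 2 * N) :
    (∑ k : ZMod (2 * N), if pr k = i then
      (if inIco (lft W) (lft W + (w : ZMod (2 * N))) k then 1 else 0) else 0)
      = Cc N w (i - W).val := by
  rw [sum_fiber _ (lft W), pr_lft]
  have h1 : (i - W).val < N := ZMod.val_lt _
  have hI : ∀ e : ℕ, e < 2 * N →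
      (inIco (lft W) (lft W + (w : ZMod (2 * N))) (lft W + (e : ZMod (2 * N))) ↔ e < w) := by
    intro e he
    unfold inIco
    rw [val_off _ he, val_off _ hw]
  unfold Cc
  simp only [hI _ (by omega : (i - W).val < 2 * N),
    hI _ (by omega : (i - W).val + N < 2 * N)]

/-- the rectangle with south-west corner the lift of `(W,S)`, width `w`, height `h` -/
def mkR {N : ℕ} (W S : ZMod N) (w h : ℕ) : Rect (2 * N) :=
  ⟨lft W, lft W + (w : ZMod (2 * N)), lft S, lft S + (h : ZMod (2 * N))⟩

theorem count4 {N : ℕ} [NeZero N] (W S i j : ZMod N) {w h : ℕ} (hw : w < 2 * N)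
    (hh : h < 2 * N) :
    (∑ p : ZMod (2 * N) × ZMod (2 * N),
      if pr p.1 = i ∧ pr p.2 = j then (mkR W S w h).mult p else 0)
      = Cc N w (i - W).val * Cc N h (j - S).val := by
  rw [← fiber_count W i hw, ← fiber_count S j hh, Fintype.sum_prod_type, Finset.sum_mul_sum]
  refine Finset.sum_congr rfl fun k _ => Finset.sum_congr rfl fun l _ => ?_
  unfold Rect.mult mkR
  by_cases h1 : pr k = i <;> by_cases h2 : pr l = j <;>
  by_cases h3 : inIco (lft W) (lft W + (w : ZMod (2 * N))) k <;>
  by_cases h4 : inIco (lft S) (lft S + (h : ZMod (2 * N))) l <;> simp [h1, h2, h3, h4]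

theorem X4_mkR {N : ℕ} [NeZero N] (G : GridDiagram N) (W S i : ZMod N) {w h : ℕ}
    (hw : w < 2 * N) (hh : h < 2 * N) :
    X4count G (mkR W S w h) i = Cc N w (i - W).val * Cc N h (G.Xrow i - S).val :=
  count4 W S i _ hw hh

theorem O4_mkR {N : ℕ} [NeZero N] (G : GridDiagram N) (W S i : ZMod N) {w h : ℕ}
    (hw : w < 2 * N) (hh : h < 2 * N) :
    O4count G (mkR W S w h) i = Cc N w (i - W).val * Cc N h (G.Orow i - S).val :=
  count4 W S i _ hw hh

theorem exists_mkR {N : ℕ} [NeZero N] (r : Rect (2 * N)) (hr : normal4 r) :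
    ∃ W S : ZMod N, ∃ w h : ℕ, w < 2 * N ∧ h < 2 * N ∧ r = mkR W S w h := by
  refine ⟨pr r.cW, pr r.rS, (r.cE - r.cW).val, (r.rN - r.rS).val, ZMod.val_lt _,
    ZMod.val_lt _, ?_⟩
  have key : ∀ u : ZMod (2 * N), u.val < N → lft (pr u) = u := by
    intro u hu
    have h0 : pr u = ((u.val : ℕ) : ZMod N) := by
      rw [← pr_nat, ZMod.natCast_zmod_val]
    unfold lft
    rw [h0, ZMod.val_natCast_of_lt hu, ZMod.natCast_zmod_val]
  unfold mkR
  rw [key _ hr.1, key _ hr.2, add_val_sub, add_val_sub]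

theorem normal4_mkR {N : ℕ} [NeZero N] (W S : ZMod N) (w h : ℕ) :
    normal4 (mkR W S w h) := by
  have key : ∀ u : ZMod N, (lft u).val < N := by
    intro u
    have h1 : u.val < N := ZMod.val_lt _
    unfold lft
    rw [ZMod.val_natCast_of_lt (by omega)]
    exact h1
  exact ⟨key _, key _⟩

/-! corners -/

theorem corner_sum {N : ℕ} [NeZero N] (c d p q : ZMod (2 * N)) :
    (if (p, q) = (c, d) then (1 : ℤ) else 0)
      + (if (p, q) = (c, d + (N : ZMod (2 * N))) then 1 else 0)
      + (if (p, q) = (c + (N : ZMod (2 * N)), d) then 1 else 0)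
      + (if (p, q) = (c + (N : ZMod (2 * N)), d + (N : ZMod (2 * N))) then 1 else 0)
    = if pr p = pr c ∧ pr q = pr d then 1 else 0 := by
  have hne : ∀ c : ZMod (2 * N), c ≠ c + (N : ZMod (2 * N)) := fun c h =>
    N_ne_zero (left_eq_add.mp h)
  simp only [pr_eq_pr_iff, Prod.mk.injEq]
  have hc := hne c
  have hd := hne d
  by_cases h1 : p = c
  · subst h1
    by_cases h3 : q = d
    · subst h3; simp [hc, hd]
    · simp [hc, h3]
  · by_cases h2 : p = c + (N : ZMod (2 * N))
    · by_cases h3 : q = d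
      · subst h3; subst h2; simp [hc.symm, hd]
      · simp [h2, h3, hc.symm]
    · simp [h1, h2]

theorem isRect4_iff_aux {N : ℕ} [NeZero N] (x y : GridState N) (r : Rect (2 * N)) :
    IsRect4From x y r ↔ r.cW ≠ r.cE ∧ r.rS ≠ r.rN ∧ ∀ i j : ZMod N,
      (if i = pr r.cE ∧ j = pr r.rS then (1 : ℤ) else 0)
      + (if i = pr r.cW ∧ j = pr r.rN then 1 else 0)
      - (if i = pr r.cW ∧ j = pr r.rS then 1 else 0)
      - (if i = pr r.cE ∧ j = pr r.rN then 1 else 0)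
      = (if y i = j then 1 else 0) - (if x i = j then 1 else 0) := by
  have hA : ∀ p : ZMod (2 * N) × ZMod (2 * N),
      cornerA r p + cornerA (trN r) p + cornerA (trE r) p + cornerA (trN (trE r)) p
      = (if pr p.1 = pr r.cE ∧ pr p.2 = pr r.rS then (1 : ℤ) else 0)
      + (if pr p.1 = pr r.cW ∧ pr p.2 = pr r.rN then 1 else 0)
      - (if pr p.1 = pr r.cW ∧ pr p.2 = pr r.rS then 1 else 0)
      - (if pr p.1 = pr r.cE ∧ pr p.2 = pr r.rN then 1 else 0) := by
    rintro ⟨p, q⟩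
    simp only [← corner_sum]
    unfold cornerA trN trE
    dsimp only
    ring
  have hB : ∀ p : ZMod (2 * N) × ZMod (2 * N),
      cornerB r p + cornerB (trN r) p + cornerB (trE r) p + cornerB (trN (trE r)) p
      = -(cornerA r p + cornerA (trN r) p + cornerA (trE r) p + cornerA (trN (trE r)) p) := by
    intro p
    unfold cornerA cornerB
    ring
  unfold IsRect4From
  constructor
  · rintro ⟨h1, h2, h3, -⟩
    refine ⟨h1, h2, fun i j => ?_⟩
    have := h3 (lft i, lft j)
    rw [hA] at this
    simpa [stInd, pr_lft] using this
  · rintro ⟨h1, h2, h3⟩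
    have h4 : ∀ p, cornerA r p + cornerA (trN r) p + cornerA (trE r) p
        + cornerA (trN (trE r)) p = stInd y p - stInd x p := by
      intro p
      rw [hA, h3]
      rfl
    refine ⟨h1, h2, h4, fun p => ?_⟩
    rw [hB, h4]; ring

theorem isRect4_iff {N : ℕ} [NeZero N] (x y : GridState N) (r : Rect (2 * N)) (hxy : x ≠ y) :
    IsRect4From x y r ↔ pr r.cW ≠ pr r.cE ∧ x (pr r.cW) = pr r.rS ∧ x (pr r.cE) = pr r.rN ∧
      y = x * Equiv.swap (pr r.cW) (pr r.cE) := by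
  rw [isRect4_iff_aux]
  constructor
  · rintro ⟨-, -, h⟩
    generalize pr r.cW = W at *
    generalize pr r.cE = E at *
    generalize pr r.rS = S at *
    generalize pr r.rN = T at *
    have hWE : W ≠ E := by
      rintro rfl
      apply hxy
      ext i
      have := h i (x i)
      by_contra hne
      have hne' : ¬ y i = x i := fun hh => hne hh.symm
      simp only [if_neg hne', if_true] at this
      omega
    have hST : S ≠ T := by
      rintro rfl
      apply hxy
      ext i
      have := h i (x i)
      by_contra hne
      have hne' : ¬ y i = x i := fun hh => hne hh.symm
      simp only [if_neg hne', if_true] at this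
      omega
    have hxW : x W = S := by
      have := h W S
      by_contra hh
      simp only [hWE, hST, hh] at this
      split_ifs at this <;> simp_all
    have hxE : x E = T := by
      have := h E T
      by_contra hh
      simp only [hWE.symm, hST.symm, hh] at this
      split_ifs at this <;> simp_all
    have hyW : y W = T := by
      have := h W T
      by_contra hh
      simp only [hWE, hST.symm, hh] at this
      split_ifs at this <;> simp_all
    have hyE : y E = S := by
      have := h E S
      by_contra hh
      simp only [hWE.symm, hST, hh] at this
      split_ifs at this <;> simp_all
    refine ⟨hWE, hxW, hxE, ?_⟩
    ext k
    rw [Equiv.Perm.mul_apply]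
    by_cases h1 : k = W
    · rw [h1, Equiv.swap_apply_left, hyW, hxE]
    · by_cases h2 : k = E
      · rw [h2, Equiv.swap_apply_right, hyE, hxW]
      · rw [Equiv.swap_apply_of_ne_of_ne h1 h2]
        have := h k (x k)
        by_contra hh
        simp [h1, h2, hh] at this
  · rintro ⟨h1, h2, h3, h4⟩
    refine ⟨fun h => h1 (by rw [h]), fun h => h1 ?_, ?_⟩
    · apply x.injective
      rw [h2, h3, h]
    · intro i j
      rw [h4, Equiv.Perm.mul_apply, ← h2, ← h3]
      generalize pr r.cW = W at *
      generalize pr r.cE = E at *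
      by_cases e1 : i = W
      · subst e1
        rw [Equiv.swap_apply_left]
        simp [h1, eq_comm]
      · by_cases e2 : i = E
        · subst e2
          rw [Equiv.swap_apply_right]
          simp [h1.symm, eq_comm]
        · rw [Equiv.swap_apply_of_ne_of_ne e1 e2]
          simp [e1, e2]

theorem isRect4_mkR {N : ℕ} [NeZero N] (x y : GridState N) (W S : ZMod N) (w h : ℕ)
    (hxy : x ≠ y) :
    IsRect4From x y (mkR W S w h) ↔ W ≠ W + w ∧ x W = S ∧ x (W + w) = S + h ∧
      y = x * Equiv.swap W (W + w) := by
  rw [isRect4_iff _ _ _ hxy]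
  simp only [mkR, pr_add', pr_nat, pr_lft]

/-! the exponent of `v` vanishes for thin rectangles -/

theorem pm4_le {N : ℕ} [NeZero N] (x : GridState N) (r : Rect (2 * N))
    (hr : ∀ d e : ZMod N, ∀ p q : ZMod (2 * N) × ZMod (2 * N),
      r.mult p = 1 → r.mult q = 1 → x (pr p.1 + d) = pr p.2 + e →
      x (pr q.1 + d) = pr q.2 + e → p = q) : rpm4 x r ≤ 1 := by
  have key : ∀ d e : ZMod (2 * N), (∑ p : ZMod (2 * N) × ZMod (2 * N),
      if x (pr p.1) = pr p.2 then ((r.mult (p.1 - d, p.2 - e) : ℤ) : ℚ) else 0) ≤ 1 := by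
    intro d e
    rw [← Equiv.sum_comp (Equiv.addRight ((d, e) : ZMod (2 * N) × ZMod (2 * N)))]
    simp only [Equiv.coe_addRight, Prod.fst_add, Prod.snd_add, add_sub_cancel_right, pr_add']
    have : ∀ p : ZMod (2 * N) × ZMod (2 * N),
        (if x (pr p.1 + pr d) = pr p.2 + pr e then ((r.mult (p.1, p.2) : ℤ) : ℚ) else 0)
        = if (x (pr p.1 + pr d) = pr p.2 + pr e ∧ r.mult p = 1) then 1 else 0 := by
      intro p
      have : r.mult p = 0 ∨ r.mult p = 1 := by
        unfold Rect.mult; split_ifs <;> simp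
      rcases this with h | h <;> simp [h]
    simp only [this]
    rw [Finset.sum_boole]
    have : (Finset.univ.filter fun p : ZMod (2 * N) × ZMod (2 * N) =>
        x (pr p.1 + pr d) = pr p.2 + pr e ∧ r.mult p = 1).card ≤ 1 := by
      rw [Finset.card_le_one]
      intro p hp q hq
      simp only [Finset.mem_filter, Finset.mem_univ, true_and] at hp hq
      exact hr _ _ p q hp.2 hq.2 hp.1 hq.1
    exact_mod_cast this
  have h1 := key 1 1
  have h2 := key 0 1
  have h3 := key 1 0
  have h4 := key 0 0
  unfold rpm4 pm4 Rect.dom4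
  have : (∑ p : ZMod (2 * N) × ZMod (2 * N),
      if x (pr p.1) = pr p.2 then
        (((r.mult (p.1 - 1, p.2 - 1) : ℤ) + (r.mult (p.1, p.2 - 1) : ℤ)
          + (r.mult (p.1 - 1, p.2) : ℤ) + (r.mult p : ℤ) : ℤ) : ℚ) else 0) ≤ 1 + 1 + 1 + 1 := by
    refine le_trans (le_of_eq ?_) (add_le_add (add_le_add (add_le_add h1 h2) h3) h4)
    rw [← Finset.sum_add_distrib, ← Finset.sum_add_distrib, ← Finset.sum_add_distrib]
    refine Finset.sum_congr rfl fun p _ => ?_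
    split_ifs
    · simp
    · simp
  linarith

theorem m4_eq_zero {N : ℕ} [NeZero N] (x y : GridState N) (r : Rect (2 * N))
    (hx : rpm4 x r ≤ 1) (hy : rpm4 y r ≤ 1) : m4 x y r = 0 := by
  unfold m4
  rw [Int.toNat_eq_zero]
  have : ⌊mQ4 x y r⌋ < 1 := by
    rw [Int.floor_lt]
    unfold mQ4
    push_cast
    linarith
  omega

theorem inIco_lft {N : ℕ} [NeZero N] {W : ZMod N} {w : ℕ} {k : ZMod (2 * N)} (hw : w < 2 * N)
    (h : inIco (lft W) (lft W + (w : ZMod (2 * N))) k) :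
    ∃ t, t < w ∧ k = lft W + (t : ZMod (2 * N)) := by
  unfold inIco at h
  rw [val_off _ hw] at h
  exact ⟨_, h, (add_val_sub _ _).symm⟩

theorem mult_mkR {N : ℕ} [NeZero N] {W S : ZMod N} {w h : ℕ} (hw : w < 2 * N)
    (hh : h < 2 * N) {p : ZMod (2 * N) × ZMod (2 * N)} (hp : (mkR W S w h).mult p = 1) :
    ∃ s t : ℕ, s < w ∧ t < h ∧ p = (lft W + (s : ZMod (2 * N)), lft S + (t : ZMod (2 * N))) := by
  unfold Rect.mult mkR at hp
  dsimp only at hp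
  split_ifs at hp with h1
  obtain ⟨s, hs, e1⟩ := inIco_lft hw h1.1
  obtain ⟨t, ht, e2⟩ := inIco_lft hh h1.2
  exact ⟨s, t, hs, ht, Prod.ext e1 e2⟩

theorem cast_inj' {N : ℕ} {s t : ℕ} (hs : s < N) (ht : t < N)
    (h : (s : ZMod N) = (t : ZMod N)) : s = t := by
  rw [ZMod.natCast_eq_natCast_iff] at h
  exact Nat.ModEq.eq_of_lt_of_lt h hs ht

theorem rpm4_thin {N : ℕ} [NeZero N] (x : GridState N) (W S : ZMod N) {w h : ℕ}
    (hw : w < N) (hh : h < N) (hthin : w = 1 ∨ h = 1) : rpm4 x (mkR W S w h) ≤ 1 := by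
  apply pm4_le
  intro d e p q hp hq hxp hxq
  obtain ⟨s, t, hs, ht, rfl⟩ := mult_mkR (by omega) (by omega) hp
  obtain ⟨s', t', hs', ht', rfl⟩ := mult_mkR (by omega) (by omega) hq
  simp only [pr_add', pr_nat, pr_lft] at hxp hxq
  rcases hthin with rfl | rfl
  · have e1 : s = 0 := by omega
    have e2 : s' = 0 := by omega
    subst e1; subst e2
    have : t = t' := by
      apply cast_inj' (N := N) (by omega) (by omega)
      have := hxp.symm.trans hxq
      simpa using this
    rw [this]
  · have e1 : t = 0 := by omega
    have e2 : t' = 0 := by omega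
    subst e1; subst e2
    have : s = s' := by
      apply cast_inj' (N := N) (by omega) (by omega)
      have := x.injective (hxp.trans hxq.symm)
      simpa using this
    rw [this]

theorem m4_thin {N : ℕ} [NeZero N] (x y : GridState N) (W S : ZMod N) {w h : ℕ}
    (hw : w < N) (hh : h < N) (hthin : w = 1 ∨ h = 1) : m4 x y (mkR W S w h) = 0 :=
  m4_eq_zero x y _ (rpm4_thin x W S hw hh hthin) (rpm4_thin y W S hw hh hthin)

/-! sums -/

theorem basisMap_single {n : ℕ} (f : GridState n → GC n) (x : GridState n) (c : Rng n) :
    basisMap f (Finsupp.single x c) = c • f x := by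
  simp [basisMap]

theorem comp_expand {n : ℕ} (c' r' : ZMod (n + 1))
    (A B : GridState (n + 1) → GridState (n + 1) → Rect (2 * (n + 1)) → Prop)
    [∀ x y, DecidablePred (A x y)] [∀ x y, DecidablePred (B x y)]
    (w1 w2 : GridState (n + 1) → GridState (n + 1) → Rect (2 * (n + 1)) → Rng (n + 1))
    (T : Finset ((GridState (n + 1) × Rect (2 * (n + 1))) ×
          (GridState (n + 1) × Rect (2 * (n + 1)))))
    (x : GridState (n + 1)) (hx : x (c' + 1) = r' + 1)
    (hT : ∀ t, t ∈ T ↔ t.1.1 (c' + 1) ≠ r' + 1 ∧ t.2.1 (c' + 1) = r' + 1 ∧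
      A x t.1.1 t.1.2 ∧ B t.1.1 t.2.1 t.2.2) :
    (pI c' r' ∘ₗ (basisMap fun x => ∑ y, ∑ r ∈ Finset.univ.filter (fun r => B x y r),
        Finsupp.single y (w2 x y r)) ∘ₗ pN c' r')
      ((pN c' r' ∘ₗ (basisMap fun x => ∑ y, ∑ r ∈ Finset.univ.filter (fun r => A x y r),
        Finsupp.single y (w1 x y r)) ∘ₗ pI c' r') (Finsupp.single x 1))
    = ∑ t ∈ T,
        Finsupp.single t.2.1 (w1 x t.1.1 t.1.2 * w2 t.1.1 t.2.1 t.2.2) := by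
  have hpI : ∀ y c, pI c' r' (Finsupp.single y c)
      = if y (c' + 1) = r' + 1 then Finsupp.single y c else 0 := by
    intro y c
    unfold pI
    rw [basisMap_single]
    split_ifs <;> simp
  have hpN : ∀ y c, pN c' r' (Finsupp.single y c)
      = if y (c' + 1) = r' + 1 then 0 else Finsupp.single y c := by
    intro y c
    unfold pN
    rw [basisMap_single]
    split_ifs <;> simp
  have hTf : T = Finset.univ.filter (fun t => t.1.1 (c' + 1) ≠ r' + 1 ∧ t.2.1 (c' + 1) = r' + 1 ∧
      A x t.1.1 t.1.2 ∧ B t.1.1 t.2.1 t.2.2) := by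
    ext t
    simp only [Finset.mem_filter, Finset.mem_univ, true_and, hT]
  rw [hTf, Finset.sum_filter, Fintype.sum_prod_type, Fintype.sum_prod_type]
  simp only [LinearMap.comp_apply, hpI, hx, if_true, basisMap_single, one_smul, map_sum, hpN]
  refine Finset.sum_congr rfl fun y _ => ?_
  rw [Finset.sum_filter]
  refine Finset.sum_congr rfl fun r _ => ?_
  by_cases hA : A x y r
  · by_cases hy : y (c' + 1) = r' + 1
    · simp [hA, hy]
    · rw [Fintype.sum_prod_type]
      simp only [hA, hy, if_true, if_false, hpN, basisMap_single, map_sum, map_smul, hpI]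
      rw [Finset.smul_sum]
      refine Finset.sum_congr rfl fun z _ => ?_
      rw [Finset.sum_filter, Finset.smul_sum]
      refine Finset.sum_congr rfl fun r2 _ => ?_
      by_cases hB : B y z r2 <;> by_cases hz : z (c' + 1) = r' + 1 <;> simp [hB, hz, hy]
  · simp [hA]

theorem Cc_pos {N d e : ℕ} (h : e < d) : 0 < Cc N d e := by
  unfold Cc; simp [h]

theorem Cc_eq_one {N d e : ℕ} (h : e < d) (hd : d ≤ N) : Cc N d e = 1 := by
  unfold Cc; rw [if_pos h, if_neg (by omega)]

theorem Cc_eq_zero {N d e : ℕ} (h : d ≤ e) : Cc N d e = 0 := by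
  unfold Cc; rw [if_neg (by omega), if_neg (by omega)]

theorem Cc_zero_le {N d e : ℕ} (h : Cc N d e = 0) : d ≤ e := by
  by_contra hh
  have := Cc_pos (N := N) (not_le.mp hh)
  omega

theorem mod2 {N t : ℕ} (h : t < 2 * N) : t % N = if t < N then t else t - N := by
  split_ifs with h1
  · exact Nat.mod_eq_of_lt h1
  · rw [Nat.mod_eq_sub_mod (by omega), Nat.mod_eq_of_lt (by omega)]

theorem Cc_last {N d : ℕ} (h0 : 0 < d) (hd : d < 2 * N) :
    Cc N d ((d - 1) % N) = if N < d then 2 else 1 := by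
  rw [mod2 (by omega)]
  unfold Cc
  split_ifs <;> omega

theorem off_shift {N : ℕ} [NeZero N] (i u : ZMod N) (d : ℕ) :
    (i - u + (d : ZMod N)).val = ((i - u).val + d) % N := by
  rw [ZMod.val_add, ZMod.val_natCast]
  simp

theorem add_cast_eq_self {N : ℕ} [NeZero N] {u : ZMod N} {d : ℕ} (h0 : 0 < d) (hd : d < 2 * N)
    (h : u + (d : ZMod N) = u) : d = N := by
  have h1 : ((d : ℕ) : ZMod N) = 0 := by simpa using h
  rw [ZMod.natCast_eq_zero_iff] at h1
  obtain ⟨k, hk⟩ := h1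
  have : k < 2 := by
    by_contra hh
    have := Nat.mul_le_mul_left N (not_lt.mp hh)
    omega
  have : k ≠ 0 := by rintro rfl; omega
  have : k = 1 := by omega
  subst this; omega

theorem class1 {N : ℕ} [NeZero N] (G : GridDiagram N) (a b : ZMod N) (x y : GridState N)
    (r : Rect (2 * N)) (hx : x a = b) (hy : y a ≠ b)
    (hr : IsRect4From x y r) (hn : normal4 r) (hX : XDisjoint4 G r) :
    ∃ (W S : ZMod N) (w h : ℕ), 0 < w ∧ w < N ∧ 0 < h ∧ h < N ∧ r = mkR W S w h ∧
      x W = S ∧ x (W + w) = S + h ∧ y = x * Equiv.swap W (W + w) ∧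
      ((W = a ∧ S = b) ∨ (W + w = a ∧ S + h = b)) := by
  obtain ⟨W, S, w, h, hw, hh, rfl⟩ := exists_mkR r hn
  have hxy : x ≠ y := by rintro rfl; exact hy hx
  rw [isRect4_mkR x y W S w h hxy] at hr
  obtain ⟨h1, h2, h3, h4⟩ := hr
  have hw0 : 0 < w := by
    rcases Nat.eq_zero_or_pos w with h0 | h0
    · subst h0; simp at h1
    · exact h0
  have hh0 : 0 < h := by
    rcases Nat.eq_zero_or_pos h with h0 | h0
    · subst h0
      rw [Nat.cast_zero, add_zero, ← h2] at h3
      exact absurd (x.injective h3).symm h1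
    · exact h0
  have hwN : w < N := by
    by_contra hcon
    obtain ⟨i, hi⟩ := G.hX.2 S
    have := hX i
    rw [X4_mkR G W S i hw hh, hi, sub_self, ZMod.val_zero] at this
    have p1 := Cc_pos (N := N) hh0
    have hv : (i - W).val < N := ZMod.val_lt _
    have p2 := Cc_pos (N := N) (show (i - W).val < w by omega)
    have := Nat.mul_pos p2 p1
    omega
  have hhN : h < N := by
    by_contra hcon
    have := hX W
    rw [X4_mkR G W S W hw hh, sub_self, ZMod.val_zero] at this
    have p1 := Cc_pos (N := N) hw0
    have hv : (G.Xrow W - S).val < N := ZMod.val_lt _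
    have p2 := Cc_pos (N := N) (show (G.Xrow W - S).val < h by omega)
    have := Nat.mul_pos p1 p2
    omega
  refine ⟨W, S, w, h, hw0, hwN, hh0, hhN, rfl, h2, h3, h4, ?_⟩
  by_cases e1 : W = a
  · left; exact ⟨e1, by rw [← h2, e1, hx]⟩
  · right
    by_cases e2 : W + w = a
    · exact ⟨e2, by rw [← h3, e2, hx]⟩
    · exfalso
      apply hy
      rw [h4, Equiv.Perm.mul_apply, Equiv.swap_apply_of_ne_of_ne (Ne.symm e1) (Ne.symm e2), hx]

theorem cast_pred' {N : ℕ} {w : ℕ} (hw : 0 < w) : ((w - 1 : ℕ) : ZMod N) = (w : ZMod N) - 1 := by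
  rw [Nat.cast_sub (by omega)]; simp

theorem class2 {N : ℕ} [NeZero N] (G : GridDiagram N) (a b : ZMod N) (hN : 2 ≤ N)
    (hX1 : G.Xrow (a - 1) = b) (hX2 : G.Xrow a = b - 1) (y z : GridState N)
    (r : Rect (2 * N)) (hy : y a ≠ b) (hz : z a = b)
    (hr : IsRect4From y z r) (hn : normal4 r) (hX : X4count G r a = 1)
    (hX' : ∀ k, k ≠ a → X4count G r k = 0) :
    ∃ (S : ZMod N) (w h : ℕ), 0 < w ∧ w < N ∧ 0 < h ∧ h < N ∧ r = mkR a S w h ∧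
      y a = S ∧ y (a + w) = b ∧ S + h = b ∧ z = y * Equiv.swap a (a + w) := by
  obtain ⟨W, S, w, h, hw, hh, rfl⟩ := exists_mkR r hn
  have hyz : y ≠ z := by rintro rfl; exact hy hz
  rw [isRect4_mkR y z W S w h hyz] at hr
  obtain ⟨h1, h2, h3, h4⟩ := hr
  have hw0 : 0 < w := by
    rcases Nat.eq_zero_or_pos w with h0 | h0
    · subst h0; simp at h1
    · exact h0
  have hwN : w ≠ N := by
    rintro rfl; simp at h1
  have hh1 : S ≠ S + h := by
    intro hc
    rw [← hc, ← h2] at h3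
    exact h1 (y.injective h3).symm
  have hh0 : 0 < h := by
    rcases Nat.eq_zero_or_pos h with h0 | h0
    · subst h0; simp at hh1
    · exact h0
  have hhN : h ≠ N := by
    rintro rfl; simp at hh1
  have hne : (a - 1 : ZMod N) ≠ a := by
    intro hc
    have h11 : ((1 : ℕ) : ZMod N) = ((0 : ℕ) : ZMod N) := by
      have := sub_eq_self.mp hc
      simpa using this
    have := cast_inj' (by omega) (by omega) h11
    omega
  by_cases e1 : W = a
  · subst e1
    have hSb : S + h = b := by
      rw [← hz, h4, Equiv.Perm.mul_apply, Equiv.swap_apply_left, h3]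
    rw [X4_mkR G W S W hw hh, sub_self, ZMod.val_zero, hX2] at hX
    have ho : b - 1 - S = ((h - 1 : ℕ) : ZMod N) := by
      rw [cast_pred' hh0, ← hSb]; ring
    rw [ho, ZMod.val_natCast, Cc_last hh0 hh] at hX
    have hw1 : Cc N w 0 = if N < w then 2 else 1 := by
      unfold Cc; simp only [hw0, if_true, zero_add]; split_ifs <;> rfl
    rw [hw1] at hX
    have hw2 : ¬ N < w := by
      intro hc; rw [if_pos hc] at hX; omega
    have hh2 : ¬ N < h := by
      intro hc; rw [if_pos hc] at hX; omega
    exact ⟨S, w, h, hw0, by omega, hh0, by omega, rfl, h2, by rw [h3, hSb], hSb, h4⟩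
  · exfalso
    by_cases e2 : W + w = a
    · have hSb : S = b := by
        rw [← hz, h4, Equiv.Perm.mul_apply, ← e2, Equiv.swap_apply_right, h2]
      have := hX' _ hne
      rw [X4_mkR G W S _ hw hh, hX1, hSb, sub_self, ZMod.val_zero] at this
      have ho : a - 1 - W = ((w - 1 : ℕ) : ZMod N) := by
        rw [cast_pred' hw0, ← e2]; ring
      rw [ho, ZMod.val_natCast, Cc_last hw0 hw] at this
      have p1 := Cc_pos (N := N) hh0
      split_ifs at this <;> omega
    · apply hy
      rw [← hz, h4, Equiv.Perm.mul_apply, Equiv.swap_apply_of_ne_of_ne (Ne.symm e1) (Ne.symm e2)]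

/-- the pair of rectangles contributing `V₁` -/
def T1 {N : ℕ} (a b : ZMod N) (x : GridState N) :
    (GridState N × Rect (2 * N)) × (GridState N × Rect (2 * N)) :=
  ((x * Equiv.swap a (a + 1), mkR a b 1 (x (a + 1) - b).val),
    (x, mkR a (x (a + 1)) 1 (N - (x (a + 1) - b).val)))

/-- the pair of rectangles contributing `V₂` -/
def T2 {N : ℕ} (a b : ZMod N) (x : GridState N) :
    (GridState N × Rect (2 * N)) × (GridState N × Rect (2 * N)) :=
  ((x * Equiv.swap (x.symm (b - 1)) a,
      mkR (x.symm (b - 1)) (b - 1) (a - x.symm (b - 1)).val 1),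
    (x, mkR a (b - 1) (N - (a - x.symm (b - 1)).val) 1))

theorem classify {N : ℕ} [NeZero N] (G : GridDiagram N) (a b : ZMod N) (hN : 2 ≤ N)
    (hX1 : G.Xrow (a - 1) = b) (hX2 : G.Xrow a = b - 1) (x y z : GridState N)
    (r s : Rect (2 * N)) (hx : x a = b) (hy : y a ≠ b) (hz : z a = b)
    (hr : IsRect4From x y r) (hn : normal4 r) (hX : XDisjoint4 G r)
    (hs : IsRect4From y z s) (hns : normal4 s) (hXs : X4count G s a = 1)
    (hXs' : ∀ k, k ≠ a → X4count G s k = 0) :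
    ((y, r), (z, s)) = T1 a b x ∨ ((y, r), (z, s)) = T2 a b x := by
  obtain ⟨W, S, w, h, hw0, hwN, hh0, hhN, rfl, hxW, hxE, hyx, hcase⟩ :=
    class1 G a b x y r hx hy hr hn hX
  obtain ⟨S', w', h', hw0', hwN', hh0', hhN', rfl, hya, hyE, hSb, hzy⟩ :=
    class2 G a b hN hX1 hX2 y z s hy hz hs hns hXs hXs'
  have hone : (1 : ZMod N) ≠ 0 := by
    intro hc
    have h11 : ((1 : ℕ) : ZMod N) = ((0 : ℕ) : ZMod N) := by simpa using hc
    have := cast_inj' (by omega) (by omega) h11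
    omega
  rcases hcase with ⟨rfl, rfl⟩ | ⟨hE, hT⟩
  · left
    have hya2 : y W = S + h := by
      rw [hyx, Equiv.Perm.mul_apply, Equiv.swap_apply_left, hxE]
    have hyE2 : y (W + w) = S := by
      rw [hyx, Equiv.Perm.mul_apply, Equiv.swap_apply_right, hxW]
    have hS' : S' = S + h := by rw [← hya, hya2]
    have hww : w' = w := by
      have := y.injective (hyE.trans hyE2.symm)
      exact cast_inj' hwN' hwN (add_left_cancel this)
    subst hww
    have hhh : h + h' = N := by
      apply add_cast_eq_self (u := S) (by omega) (by omega)
      rw [Nat.cast_add, ← add_assoc, ← hS', hSb]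
    have hw1 : w' = 1 := by
      by_contra hne
      have hlt : (1 : ℕ) < w' := by omega
      have hv1 : (W + 1 - W : ZMod N).val = 1 := by
        have := val_off W (show 1 < N by omega)
        simpa using this
      have c1 := hX (W + 1)
      have c2 := hXs' (W + 1) (by simpa using hone)
      rw [X4_mkR G _ _ _ (by omega) (by omega), hv1] at c1 c2
      have p1 := Cc_pos (N := N) hlt
      have d1 := Cc_zero_le ((Nat.mul_eq_zero.mp c1).resolve_left (by omega))
      have d2 := Cc_zero_le ((Nat.mul_eq_zero.mp c2).resolve_left (by omega))
      have ho : G.Xrow (W + 1) - S' = G.Xrow (W + 1) - S + (h' : ZMod N) := by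
        rw [← hSb]; ring
      have hv : (G.Xrow (W + 1) - S).val < N := ZMod.val_lt _
      rw [ho, off_shift, mod2 (by omega)] at d2
      split_ifs at d2 <;> omega
    subst hw1
    have hzx : z = x := by
      rw [hzy, hyx, mul_assoc, Equiv.swap_mul_self, mul_one]
    have hx1 : x (W + 1) = S + h := by
      simpa using hxE
    have hhv : (x (W + 1) - S).val = h := by
      rw [hx1, val_off S hhN]
    have hh' : h' = N - h := by omega
    unfold T1
    rw [hhv, hx1, hzx, hyx, hS', hh', Nat.cast_one]
  · right
    have hyW : y W = b := by
      rw [hyx, Equiv.Perm.mul_apply, Equiv.swap_apply_left, hE, hx]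
    have hya2 : y a = S := by
      rw [hyx, Equiv.Perm.mul_apply, ← hE, Equiv.swap_apply_right, hxW]
    have hS' : S' = S := by rw [← hya, hya2]
    subst hS'
    have hhh : h' = h := by
      exact cast_inj' hhN' hhN (add_left_cancel (hSb.trans hT.symm))
    subst hhh
    have haw : a + w' = W := y.injective (hyE.trans hyW.symm)
    have hww : w + w' = N := by
      apply add_cast_eq_self (u := W) (by omega) (by omega)
      rw [Nat.cast_add, ← add_assoc, hE, haw]
    have hh1 : h' = 1 := by
      by_contra hne
      obtain ⟨i, hi⟩ := G.hX.2 (b - 2)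
      have hia : i ≠ a := by
        rintro rfl
        rw [hX2] at hi
        apply hone
        linear_combination hi
      have c1 := hX i
      have c2 := hXs' i hia
      have ho : b - 2 - S' = ((h' - 2 : ℕ) : ZMod N) := by
        rw [Nat.cast_sub (by omega), ← hSb]; push_cast; ring
      rw [X4_mkR G _ _ _ (by omega) (by omega), hi, ho,
        ZMod.val_natCast_of_lt (by omega)] at c1 c2
      have p1 := Cc_pos (N := N) (show h' - 2 < h' by omega)
      have d1 := Cc_zero_le ((Nat.mul_eq_zero.mp c1).resolve_right (by omega))
      have d2 := Cc_zero_le ((Nat.mul_eq_zero.mp c2).resolve_right (by omega))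
      have ho2 : i - W = i - a + (w : ZMod N) := by
        rw [← hE]; ring
      have hv : (i - a).val < N := ZMod.val_lt _
      rw [ho2, off_shift, mod2 (by omega)] at d1
      split_ifs at d1 <;> omega
    subst hh1
    have hS1 : S' = b - 1 := by
      rw [← hSb]; simp
    have hW : x.symm (b - 1) = W := by
      rw [← hS1, ← hxW, Equiv.symm_apply_apply]
    have hwv : (a - W).val = w := by
      rw [← hE, val_off W hwN]
    have haE : a + (w' : ZMod N) = W := haw
    have hzx : z = x := by
      rw [hzy, hyx, haE, hE, Equiv.swap_comm a W, mul_assoc, Equiv.swap_mul_self, mul_one]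
    have hw' : w' = N - w := by omega
    unfold T2
    rw [hW, hwv, hzx, hyx, hS1, hw', hE]

/-- the conditions on the pair of rectangles, as used in the composition `𝓗_{X₂} ∘ ∂` -/
def Good {N : ℕ} [NeZero N] (G : GridDiagram N) (a b : ZMod N) (x : GridState N)
    (t : (GridState N × Rect (2 * N)) × (GridState N × Rect (2 * N))) : Prop :=
  t.1.1 a ≠ b ∧ t.2.1 a = b ∧
    (IsRect4From x t.1.1 t.1.2 ∧ normal4 t.1.2 ∧ XDisjoint4 G t.1.2) ∧
    (IsRect4From t.1.1 t.2.1 t.2.2 ∧ normal4 t.2.2 ∧ X4count G t.2.2 a = 1 ∧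
      ∀ k, k ≠ a → X4count G t.2.2 k = 0)

theorem one_ne_zero' {N : ℕ} (hN : 2 ≤ N) : (1 : ZMod N) ≠ 0 := by
  intro hc
  have h11 : ((1 : ℕ) : ZMod N) = ((0 : ℕ) : ZMod N) := by simpa using hc
  have := cast_inj' (by omega) (by omega) h11
  omega

theorem val_pos_of_ne {N : ℕ} [NeZero N] {u v : ZMod N} (h : u ≠ v) : 0 < (u - v).val := by
  rw [Nat.pos_iff_ne_zero, Ne, ZMod.val_eq_zero, sub_eq_zero]
  exact h

/-- offset from the other end of a complementary arc -/
theorem off_compl {N : ℕ} [NeZero N] (i u : ZMod N) {d : ℕ} (hd : d < N) :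
    (i - u).val = if (i - (u + (d : ZMod N))).val + d < N
      then (i - (u + (d : ZMod N))).val + d else (i - (u + (d : ZMod N))).val + d - N := by
  have h : i - u = i - (u + (d : ZMod N)) + (d : ZMod N) := by ring
  have hv : (i - (u + (d : ZMod N))).val < N := ZMod.val_lt _
  have h2 : (i - u).val = (i - (u + (d : ZMod N)) + (d : ZMod N)).val := by rw [← h]
  rw [h2, off_shift, mod2 (by omega)]

theorem Cc_one {N : ℕ} [NeZero N] (i u : ZMod N) :
    Cc N 1 (i - u).val = if i = u then 1 else 0 := by
  have hN := NeZero.ne N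
  split_ifs with h
  · rw [h, sub_self, ZMod.val_zero]; exact Cc_eq_one (by omega) (by omega)
  · exact Cc_eq_zero (val_pos_of_ne h)

theorem good_T1 {N : ℕ} [NeZero N] (G : GridDiagram N) (a b : ZMod N) (hN : 2 ≤ N)
    (hX2 : G.Xrow a = b - 1) (x : GridState N) (hx : x a = b) : Good G a b x (T1 a b x) := by
  have hone := one_ne_zero' hN
  have hne : a ≠ a + 1 := by simpa using hone
  have hxne : x (a + 1) ≠ b := by
    rw [← hx]; exact fun h => hne (x.injective h).symm
  have h0 := val_pos_of_ne hxne
  have hlt : (x (a + 1) - b).val < N := ZMod.val_lt _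
  have hxh := add_val_sub b (x (a + 1))
  have hya : (x * Equiv.swap a (a + 1)) a = x (a + 1) := by simp
  have hyE : (x * Equiv.swap a (a + 1)) (a + 1) = b := by simp [hx]
  have hxy : x ≠ x * Equiv.swap a (a + 1) := by
    intro h
    apply hxne
    rw [← hya, ← h, hx]
  unfold Good T1
  dsimp only
  generalize (x (a + 1) - b).val = h at *
  have hb : x (a + 1) + ((N - h : ℕ) : ZMod N) = b := by
    rw [← hxh, add_assoc, ← Nat.cast_add, Nat.add_sub_cancel' hlt.le]; simp
  refine ⟨by rwa [hya], hx, ⟨?_, normal4_mkR _ _ _ _, ?_⟩, ?_, normal4_mkR _ _ _ _, ?_, ?_⟩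
  · rw [isRect4_mkR _ _ _ _ _ _ hxy, Nat.cast_one]
    exact ⟨hne, hx, hxh.symm, rfl⟩
  · intro i
    rw [X4_mkR G _ _ _ (by omega) (by omega), Cc_one]
    split_ifs with hi
    · subst hi
      rw [hX2, one_mul]
      apply Cc_eq_zero
      have : (i - i : ZMod N) = 0 := sub_self i
      have hm : b - 1 - b = ((N - 1 : ℕ) : ZMod N) := by
        rw [Nat.cast_sub (by omega)]; simp
      rw [hm, ZMod.val_natCast_of_lt (by omega)]
      omega
    · simp
  · rw [isRect4_mkR _ _ _ _ _ _ hxy.symm, Nat.cast_one]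
    refine ⟨hne, hya, by rw [hyE, hb], ?_⟩
    rw [mul_assoc, Equiv.swap_mul_self, mul_one]
  · rw [X4_mkR G _ _ _ (by omega) (by omega), Cc_one, if_pos rfl, one_mul, hX2]
    apply Cc_eq_one _ (by omega)
    have hm : b - 1 - x (a + 1) = ((N - h - 1 : ℕ) : ZMod N) := by
      rw [cast_pred' (by omega)]
      nth_rewrite 1 [← hb]
      ring
    rw [hm, ZMod.val_natCast_of_lt (by omega)]
    omega
  · intro k hk
    rw [X4_mkR G _ _ _ (by omega) (by omega), Cc_one, if_neg hk, zero_mul]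

theorem good_T2 {N : ℕ} [NeZero N] (G : GridDiagram N) (a b : ZMod N) (hN : 2 ≤ N)
    (hX2 : G.Xrow a = b - 1) (x : GridState N) (hx : x a = b) : Good G a b x (T2 a b x) := by
  have hone := one_ne_zero' hN
  have hbne : b - 1 ≠ b := by simpa using hone
  have hxW : x (x.symm (b - 1)) = b - 1 := x.apply_symm_apply _
  unfold Good T2
  dsimp only
  generalize x.symm (b - 1) = W at *
  have hne : a ≠ W := by
    rintro rfl
    exact hbne (hxW.symm.trans hx)
  have h0 := val_pos_of_ne hne
  have hlt : (a - W).val < N := ZMod.val_lt _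
  have hE := add_val_sub W a
  have hya : (x * Equiv.swap W a) a = b - 1 := by simp [hxW]
  have hyW : (x * Equiv.swap W a) W = b := by simp [hx]
  have hxy : x ≠ x * Equiv.swap W a := by
    intro h
    apply hbne
    rw [← hya, ← h, hx]
  generalize (a - W).val = w at *
  have hW : a + ((N - w : ℕ) : ZMod N) = W := by
    rw [← hE, add_assoc, ← Nat.cast_add, Nat.add_sub_cancel' hlt.le]; simp
  have hXiff : ∀ i, G.Xrow i = b - 1 → i = a := fun i hi => G.hX.1 (hi.trans hX2.symm)
  refine ⟨by rwa [hya], hx, ⟨?_, normal4_mkR _ _ _ _, ?_⟩, ?_, normal4_mkR _ _ _ _, ?_, ?_⟩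
  · rw [isRect4_mkR _ _ _ _ _ _ hxy, Nat.cast_one, hE]
    exact ⟨hne.symm, hxW, by rw [hx]; ring, rfl⟩
  · intro i
    rw [X4_mkR G _ _ _ (by omega) (by omega), Cc_one]
    split_ifs with hi
    · rw [hXiff i hi, mul_one]
      apply Cc_eq_zero
      rw [← hE, val_off W hlt]
    · simp
  · rw [isRect4_mkR _ _ _ _ _ _ hxy.symm, Nat.cast_one, hW]
    refine ⟨hne, hya, by rw [hyW]; ring, ?_⟩
    rw [Equiv.swap_comm a W, mul_assoc, Equiv.swap_mul_self, mul_one]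
  · rw [X4_mkR G _ _ _ (by omega) (by omega), hX2, Cc_one, if_pos rfl, mul_one, sub_self,
      ZMod.val_zero]
    exact Cc_eq_one (by omega) (by omega)
  · intro k hk
    rw [X4_mkR G _ _ _ (by omega) (by omega), Cc_one, if_neg (fun h => hk (hXiff k h)), mul_zero]

/-! weights -/

theorem wt4_of {N : ℕ} [NeZero N] (G : GridDiagram N) (x y : GridState N) (r : Rect (2 * N))
    (hm : m4 x y r = 0) (j : ZMod N) (d : ℕ)
    (hO : ∀ i, O4count G r i = if i = j then d else 0) : wt4 G x y r = Vv j ^ d := by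
  unfold wt4
  rw [hm, pow_zero, mul_one, Finset.prod_eq_single j]
  · rw [hO, if_pos rfl]
  · intro i _ hi
    rw [hO, if_neg hi, pow_zero]
  · simp

theorem O4_T1 {N : ℕ} [NeZero N] (G : GridDiagram N) (a b : ZMod N) (hN : 2 ≤ N)
    (hO1 : G.Orow a = b) (x : GridState N) (hx : x a = b) (i : ZMod N) :
    O4count G (T1 a b x).1.2 i = (if i = a then 1 else 0) ∧
    O4count G (T1 a b x).2.2 i = 0 := by
  have hone := one_ne_zero' hN
  have hne : a ≠ a + 1 := by simpa using hone
  have hxne : x (a + 1) ≠ b := by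
    rw [← hx]; exact fun h => hne (x.injective h).symm
  have h0 := val_pos_of_ne hxne
  have hlt : (x (a + 1) - b).val < N := ZMod.val_lt _
  have hxh := add_val_sub b (x (a + 1))
  unfold T1
  dsimp only
  generalize (x (a + 1) - b).val = h at *
  have hb : x (a + 1) + ((N - h : ℕ) : ZMod N) = b := by
    rw [← hxh, add_assoc, ← Nat.cast_add, Nat.add_sub_cancel' hlt.le]; simp
  rw [O4_mkR G _ _ _ (by omega) (by omega), O4_mkR G _ _ _ (by omega) (by omega), Cc_one]
  by_cases hi : i = a
  · subst hi
    rw [hO1, if_pos rfl, one_mul, one_mul, sub_self, ZMod.val_zero]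
    refine ⟨Cc_eq_one h0 hlt.le, Cc_eq_zero ?_⟩
    nth_rewrite 1 [← hb]
    rw [val_off _ (by omega)]
  · simp [hi]

theorem O4_T2 {N : ℕ} [NeZero N] (G : GridDiagram N) (a b j : ZMod N) (hN : 2 ≤ N)
    (hO2 : G.Orow j = b - 1) (x : GridState N) (hx : x a = b) :
    ∃ d e : ℕ, d + e = 1 ∧ (∀ i, O4count G (T2 a b x).1.2 i = if i = j then d else 0) ∧
    ∀ i, O4count G (T2 a b x).2.2 i = if i = j then e else 0 := by
  have hone := one_ne_zero' hN
  have hbne : b - 1 ≠ b := by simpa using hone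
  have hxW : x (x.symm (b - 1)) = b - 1 := x.apply_symm_apply _
  unfold T2
  dsimp only
  generalize x.symm (b - 1) = W at *
  have hne : a ≠ W := by
    rintro rfl
    exact hbne (hxW.symm.trans hx)
  have h0 := val_pos_of_ne hne
  have hlt : (a - W).val < N := ZMod.val_lt _
  have hE := add_val_sub W a
  generalize (a - W).val = w at *
  have hOiff : ∀ i, G.Orow i = b - 1 ↔ i = j :=
    fun i => ⟨fun hi => G.hO.1 (hi.trans hO2.symm), fun hi => by rw [hi, hO2]⟩
  refine ⟨Cc N w (j - W).val, Cc N (N - w) (j - a).val, ?_, ?_, ?_⟩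
  · have ho := off_compl j W hlt
    rw [hE] at ho
    have hv : (j - a).val < N := ZMod.val_lt _
    rw [ho]
    unfold Cc
    split_ifs <;> omega
  · intro i
    rw [O4_mkR G _ _ _ (by omega) (by omega), Cc_one]
    simp only [hOiff]
    split_ifs with hi
    · rw [hi, mul_one]
    · simp
  · intro i
    rw [O4_mkR G _ _ _ (by omega) (by omega), Cc_one]
    simp only [hOiff]
    split_ifs with hi
    · rw [hi, mul_one]
    · simp

theorem m4_T {N : ℕ} [NeZero N] (a b : ZMod N) (hN : 2 ≤ N) (x y z : GridState N)
    (hx : x a = b) :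
    m4 y z (T1 a b x).1.2 = 0 ∧ m4 y z (T1 a b x).2.2 = 0 ∧
    m4 y z (T2 a b x).1.2 = 0 ∧ m4 y z (T2 a b x).2.2 = 0 := by
  have hone := one_ne_zero' hN
  have h1 : 0 < (x (a + 1) - b).val := by
    apply val_pos_of_ne
    rw [← hx]
    intro h
    have := x.injective h
    exact hone (by simpa using this)
  have h2 : 0 < (a - x.symm (b - 1)).val := by
    apply val_pos_of_ne
    intro h
    have : x a = b - 1 := by rw [h, Equiv.apply_symm_apply]
    rw [hx] at this
    exact hone (by simpa using this.symm)
  have h3 : (x (a + 1) - b).val < N := ZMod.val_lt _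
  have h4 : (a - x.symm (b - 1)).val < N := ZMod.val_lt _
  exact ⟨m4_thin _ _ _ _ (by omega) h3 (Or.inl rfl),
    m4_thin _ _ _ _ (by omega) (by omega) (Or.inl rfl),
    m4_thin _ _ _ _ h4 (by omega) (Or.inr rfl),
    m4_thin _ _ _ _ (by omega) (by omega) (Or.inr rfl)⟩


/-- For a stabilization of type `X:SW`:
`𝓗_{X₂}^{I₄} ∘ 𝓗_{O₁}• = Id` on `I₄`, and
`𝓗_{X₂}^{I₄} ∘ ∂_{I₄}^{N₄} = V₁ + V₂` (`= V₁ − V₂` over `𝔽 = ℤ/2ℤ`) as maps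
`I₄ → I₄` (here `V₁` is the variable of the new marking `O₁`, in column `c'+1`,
and `V₂` is the variable of `O₂`, the `O`-marking in the row `r'` just south of
the row of `O₁`). -/
theorem statement16 (n : ℕ) [NeZero n] (G : GridDiagram n) (G' : GridDiagram (n + 1))
    (c' r' : ZMod (n + 1)) (hst : IsStabAt G G' c' r' false false true) :
    hX2I G' c' r' ∘ₗ hO1N G' c' r' = pI c' r' ∧
    hX2I G' c' r' ∘ₗ dIN G' c' r'
      = (Vv (c' + 1) + Vv ((Equiv.ofBijective G'.Orow G'.hO).symm r')) • pI c' r' := by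
  have hN : 2 ≤ n + 1 := by
    have := NeZero.ne n
    omega
  simp only [IsStabAt, if_true] at hst
  obtain ⟨⟨hO1, hX1, hX2, -, -⟩, -⟩ := hst
  simp only [Bool.false_eq_true, if_false] at hO1 hX1 hX2
  have hO2 : G'.Orow ((Equiv.ofBijective G'.Orow G'.hO).symm r') = (r' + 1) - 1 := by
    rw [add_sub_cancel_right]
    exact Equiv.ofBijective_apply_symm_apply G'.Orow G'.hO r'
  generalize (Equiv.ofBijective G'.Orow G'.hO).symm r' = j at *
  have hX1' : G'.Xrow ((c' + 1) - 1) = r' + 1 := by rw [add_sub_cancel_right, hX1]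
  have hX2' : G'.Xrow (c' + 1) = (r' + 1) - 1 := by rw [add_sub_cancel_right, hX2]
  have hcls : ∀ (x : GridState (n + 1)) t, x (c' + 1) = r' + 1 →
      (Good G' (c' + 1) (r' + 1) x t ↔
        t = T1 (c' + 1) (r' + 1) x ∨ t = T2 (c' + 1) (r' + 1) x) := by
    rintro x ⟨⟨y, r⟩, ⟨z, s⟩⟩ hx
    constructor
    · rintro ⟨h1, h2, ⟨h3, h4, h5⟩, h6, h7, h8, h9⟩
      exact classify G' _ _ hN hX1' hX2' x y z r s hx h1 h2 h3 h4 h5 h6 h7 h8 h9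
    · rintro (h | h)
      · rw [h]; exact good_T1 G' _ _ hN hX2' x hx
      · rw [h]; exact good_T2 G' _ _ hN hX2' x hx
  have hOT2 : ∀ x : GridState (n + 1), x (c' + 1) = r' + 1 →
      O4count G' (T2 (c' + 1) (r' + 1) x).1.2 (c' + 1) = 0 := by
    intro x hx
    obtain ⟨d, e, -, h1, -⟩ := O4_T2 G' (c' + 1) (r' + 1) j hN hO2 x hx
    rw [h1, if_neg]
    rintro rfl
    rw [hO1] at hO2
    exact one_ne_zero' hN (by simpa using hO2)
  have hOT1 : ∀ x : GridState (n + 1), x (c' + 1) = r' + 1 →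
      O4count G' (T1 (c' + 1) (r' + 1) x).1.2 (c' + 1) = 1 := by
    intro x hx
    rw [(O4_T1 G' _ _ hN hO1 x hx _).1, if_pos rfl]
  have hpI : ∀ (x : GridState (n + 1)), x (c' + 1) = r' + 1 →
      pI c' r' (Finsupp.single x 1) = Finsupp.single x 1 := by
    intro x hx
    unfold pI
    rw [basisMap_single, if_pos hx, one_smul]
  have hpI0 : ∀ (x : GridState (n + 1)), x (c' + 1) ≠ r' + 1 →
      pI c' r' (Finsupp.single x 1) = 0 := by
    intro x hx
    unfold pI
    rw [basisMap_single, if_neg hx, one_smul]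
  constructor
  · refine Finsupp.lhom_ext' fun x => LinearMap.ext_ring ?_
    change hX2I G' c' r' (hO1N G' c' r' (Finsupp.single x 1)) = pI c' r' (Finsupp.single x 1)
    by_cases hx : x (c' + 1) = r' + 1
    · rw [hpI x hx]
      refine (comp_expand c' r' (fun x y r => IsRect4From x y r ∧ normal4 r ∧
        XDisjoint4 G' r ∧ O4count G' r (c' + 1) = 1)
        (fun x y r => IsRect4From x y r ∧ normal4 r ∧ X4count G' r (c' + 1) = 1 ∧
          ∀ k, k ≠ c' + 1 → X4count G' r k = 0)
        (fun x y r => wtNo G' x y (c' + 1) r) (wt4 G') {T1 (c' + 1) (r' + 1) x} x hx (fun t => ?_)).trans ?_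
      · simp only [Finset.mem_singleton]
        rw [iff_comm]
        constructor
        · rintro ⟨h1, h2, ⟨h3, h4, h5, h6⟩, h7⟩
          rcases (hcls x t hx).mp ⟨h1, h2, ⟨h3, h4, h5⟩, h7⟩ with h | h
          · exact h
          · rw [h, hOT2 x hx] at h6
            omega
        · intro h
          obtain ⟨h1, h2, ⟨h3, h4, h5⟩, h7⟩ := (hcls x t hx).mpr (Or.inl h)
          exact ⟨h1, h2, ⟨h3, h4, h5, by rw [h, hOT1 x hx]⟩, h7⟩
      rw [Finset.sum_singleton]
      have e1 : wtNo G' x (T1 (c' + 1) (r' + 1) x).1.1 (c' + 1)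
          (T1 (c' + 1) (r' + 1) x).1.2 = 1 := by
        unfold wtNo
        rw [(m4_T _ _ hN x _ _ hx).1, pow_zero, mul_one]
        apply Finset.prod_eq_one
        intro i hi
        rw [(O4_T1 G' _ _ hN hO1 x hx i).1, if_neg (Finset.ne_of_mem_erase hi), pow_zero]
      have e2 : wt4 G' (T1 (c' + 1) (r' + 1) x).1.1 (T1 (c' + 1) (r' + 1) x).2.1
          (T1 (c' + 1) (r' + 1) x).2.2 = 1 := by
        rw [wt4_of G' _ _ _ (m4_T _ _ hN x _ _ hx).2.1 j 0 (fun i => by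
          rw [(O4_T1 G' _ _ hN hO1 x hx i).2, ite_self]), pow_zero]
      rw [e1, e2, one_mul]
      rfl
    · unfold hO1N
      rw [hpI0 x hx, LinearMap.comp_apply, LinearMap.comp_apply, hpI0 x hx]
      simp only [map_zero]
  · refine Finsupp.lhom_ext' fun x => LinearMap.ext_ring ?_
    change hX2I G' c' r' (dIN G' c' r' (Finsupp.single x 1)) =
      (Vv (c' + 1) + Vv j) • pI c' r' (Finsupp.single x 1)
    by_cases hx : x (c' + 1) = r' + 1
    · rw [hpI x hx]
      refine (comp_expand c' r' (fun x y r => IsRect4From x y r ∧ normal4 r ∧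
        XDisjoint4 G' r)
        (fun x y r => IsRect4From x y r ∧ normal4 r ∧ X4count G' r (c' + 1) = 1 ∧
          ∀ k, k ≠ c' + 1 → X4count G' r k = 0)
        (wt4 G') (wt4 G') {T1 (c' + 1) (r' + 1) x, T2 (c' + 1) (r' + 1) x} x hx (fun t => ?_)).trans ?_
      · simp only [Finset.mem_insert,
          Finset.mem_singleton]
        exact (hcls x t hx).symm
      have hTne : T1 (c' + 1) (r' + 1) x ≠ T2 (c' + 1) (r' + 1) x := by
        intro h
        have h1 := hOT1 x hx
        rw [h, hOT2 x hx] at h1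
        omega
      rw [Finset.sum_pair hTne]
      have e1 : wt4 G' x (T1 (c' + 1) (r' + 1) x).1.1 (T1 (c' + 1) (r' + 1) x).1.2
          = Vv (c' + 1) := by
        rw [wt4_of G' _ _ _ (m4_T _ _ hN x _ _ hx).1 (c' + 1) 1 (fun i =>
          (O4_T1 G' _ _ hN hO1 x hx i).1), pow_one]
      have e2 : wt4 G' (T1 (c' + 1) (r' + 1) x).1.1 (T1 (c' + 1) (r' + 1) x).2.1
          (T1 (c' + 1) (r' + 1) x).2.2 = 1 := by
        rw [wt4_of G' _ _ _ (m4_T _ _ hN x _ _ hx).2.1 j 0 (fun i => by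
          rw [(O4_T1 G' _ _ hN hO1 x hx i).2, ite_self]), pow_zero]
      obtain ⟨d, e, hde, hd, he⟩ := O4_T2 G' (c' + 1) (r' + 1) j hN hO2 x hx
      have e3 : wt4 G' x (T2 (c' + 1) (r' + 1) x).1.1 (T2 (c' + 1) (r' + 1) x).1.2
          = Vv j ^ d :=
        wt4_of G' _ _ _ (m4_T _ _ hN x _ _ hx).2.2.1 j d hd
      have e4 : wt4 G' (T2 (c' + 1) (r' + 1) x).1.1 (T2 (c' + 1) (r' + 1) x).2.1
          (T2 (c' + 1) (r' + 1) x).2.2 = Vv j ^ e :=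
        wt4_of G' _ _ _ (m4_T _ _ hN x _ _ hx).2.2.2 j e he
      rw [e1, e2, e3, e4, mul_one, ← pow_add, hde, pow_one]
      have z1 : (T1 (c' + 1) (r' + 1) x).2.1 = x := rfl
      have z2 : (T2 (c' + 1) (r' + 1) x).2.1 = x := rfl
      rw [z1, z2, ← Finsupp.single_add, Finsupp.smul_single, smul_eq_mul, mul_one]
    · unfold dIN
      rw [hpI0 x hx, LinearMap.comp_apply, LinearMap.comp_apply, hpI0 x hx]
      simp only [map_zero, smul_zero]

end GridHomology
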